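/- arXiv:1712.07421 — 3 statements merged into one kernel-verified Lean document; each statement's English description precedes it below -/
import Mathlib

section
/- Let X be a set of n ≥ 6 points in the Euclidean plane in general position. Then for every integer r with 1 ≤ r ≤ ⌊(n−1)/2⌋, the flip graph of plane spanning trees G_X^S contains a 2r-rainbow cycle. -/
/-! Rainbow cycles in the flip graph of plane spanning trees on a point set
`X` in the Euclidean plane in general position. -/

/-- A finite point set in the plane is in general position if no three of its
points are collinear. -/
def GeneralPosition (X : Finset (ℝ × ℝ)) : Prop :=
  ∀ p ∈ X, ∀ q ∈ X, ∀ r ∈ X, p ≠ q → p ≠ r → q ≠ r →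
    ¬ Collinear ℝ ({p, q, r} : Set (ℝ × ℝ))

/-- The closed straight-line segment realizing an unordered pair of points. -/
def seg : Sym2 (ℝ × ℝ) → Set (ℝ × ℝ) :=
  Sym2.lift ⟨fun p q => segment ℝ p q, fun p q => segment_symm ℝ p q⟩

/-- `T` is a plane spanning tree on the finite point set `X`: its edges are
unordered pairs of distinct points of `X`, it is connected and has `|X| - 1`
edges (hence is a spanning tree), and the closed segments realizing two
distinct edges intersect in at most a common endpoint. -/
def IsPlaneSpanningTree (X : Finset (ℝ × ℝ)) (T : Finset (Sym2 (ℝ × ℝ))) : Prop :=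
  (∀ e ∈ T, ∃ p q : ℝ × ℝ, e = s(p, q) ∧ p ≠ q ∧ p ∈ X ∧ q ∈ X) ∧
  T.card = X.card - 1 ∧
  (∀ p ∈ X, ∀ q ∈ X, Relation.ReflTransGen (fun a b => s(a, b) ∈ T) p q) ∧
  (∀ e ∈ T, ∀ f ∈ T, e ≠ f → ∀ x ∈ seg e, x ∈ seg f → x ∈ e ∧ x ∈ f)

/-- An `r`-rainbow cycle of length `L` in the flip graph `G_X^S` of plane
spanning trees on `X`, encoded as an `L`-periodic sequence `V` of plane
spanning trees: consecutive trees differ in a flip (removing one edge `e` and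
inserting another edge `f`, which is the label of the arc), no tree is visited
twice within a period, and every pair of distinct points of `X` appears as an
arc label (i.e. enters the tree) exactly `r` times per period. -/
def IsRainbowCycleS (X : Finset (ℝ × ℝ)) (r L : ℕ)
    (V : ℕ → Finset (Sym2 (ℝ × ℝ))) : Prop :=
  0 < L ∧
  (∀ i, V (i + L) = V i) ∧
  (∀ i < L, ∀ j < L, V i = V j → i = j) ∧
  (∀ i, IsPlaneSpanningTree X (V i)) ∧
  (∀ i, ∃ e f, e ∈ V i ∧ f ∉ V i ∧ V (i + 1) = insert f ((V i).erase e)) ∧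
  (∀ p ∈ X, ∀ q ∈ X, p ≠ q →
    ((Finset.range L).filter (fun i => s(p, q) ∈ V (i + 1) ∧ s(p, q) ∉ V i)).card = r)

/-- Twice the signed area of the triangle `a b c`: it is positive when `c` lies to the left of the
directed line from `a` to `b`. -/
def orient (a b c : ℝ × ℝ) : ℝ :=
  (b.1 - a.1) * (c.2 - a.2) - (b.2 - a.2) * (c.1 - a.1)

lemma orient_swap (a b c : ℝ × ℝ) : orient a c b = -orient a b c := by
  unfold orient; ring

lemma orient_rotate (a b c : ℝ × ℝ) : orient b c a = orient a b c := by
  unfold orient; ring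

lemma orient_swap_left (a b c : ℝ × ℝ) : orient b a c = -orient a b c := by
  unfold orient; ring

@[simp] lemma orient_self_right (a b : ℝ × ℝ) : orient a b b = 0 := by
  unfold orient; ring

@[simp] lemma orient_self_left (a b : ℝ × ℝ) : orient a b a = 0 := by
  unfold orient; ring

lemma orient_add_smul (a b c d : ℝ × ℝ) {α β : ℝ} (h : α + β = 1) :
    orient a b (α • c + β • d) = α * orient a b c + β * orient a b d := by
  simp only [orient, Prod.fst_add, Prod.snd_add, Prod.smul_fst, Prod.smul_snd, smul_eq_mul]
  linear_combination ((b.1 - a.1) * a.2 - (b.2 - a.2) * a.1) * h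

lemma collinear_of_orient_eq_zero {a b c : ℝ × ℝ} (hab : a ≠ b) (h : orient a b c = 0) :
    Collinear ℝ ({a, b, c} : Set (ℝ × ℝ)) := by
  rw [collinear_iff_of_mem (p₀ := a) (by simp)]
  refine ⟨b - a, ?_⟩
  rintro z (rfl | rfl | rfl)
  · exact ⟨0, by simp⟩
  · exact ⟨1, by simp⟩
  · unfold orient at h
    by_cases h1 : b.1 - a.1 = 0
    · have h2 : b.2 - a.2 ≠ 0 := by
        intro h2
        exact hab (Prod.ext (by linarith) (by linarith))
      refine ⟨(z.2 - a.2) / (b.2 - a.2), Prod.ext ?_ ?_⟩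
      · have : (b.2 - a.2) * (z.1 - a.1) = 0 := by rw [h1] at h; linarith
        have := (mul_eq_zero.1 this).resolve_left h2
        simp [h1]; linarith
      · simp; field_simp; ring
    · refine ⟨(z.1 - a.1) / (b.1 - a.1), Prod.ext ?_ ?_⟩
      · simp; field_simp; ring
      · simp; field_simp; linarith

lemma GeneralPosition.orient_ne_zero {X : Finset (ℝ × ℝ)} (hgen : GeneralPosition X)
    {a b c : ℝ × ℝ} (ha : a ∈ X) (hb : b ∈ X) (hc : c ∈ X) (hab : a ≠ b) (hac : a ≠ c)
    (hbc : b ≠ c) : orient a b c ≠ 0 := fun h =>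
  hgen a ha b hb c hc hab hac hbc (collinear_of_orient_eq_zero hab h)

lemma disjoint_segment_of_orient {u v a b c d : ℝ × ℝ} (ha : orient u v a ≤ 0)
    (hb : orient u v b ≤ 0) (hc : 0 < orient u v c) (hd : 0 < orient u v d) :
    Disjoint (segment ℝ a b) (segment ℝ c d) := by
  rw [Set.disjoint_left]
  rintro z ⟨α, β, hα, hβ, hαβ, rfl⟩ ⟨γ, δ, hγ, hδ, hγδ, h⟩
  have h1 := orient_add_smul u v a b hαβ
  have h2 := orient_add_smul u v c d hγδ
  rw [h, h1] at h2
  have h3 : 0 < γ * orient u v c + δ * orient u v d := by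
    rcases hγ.eq_or_lt with rfl | hγ
    · have : δ = 1 := by linarith
      simpa [this] using hd
    · have := mul_nonneg hδ hd.le
      have := mul_pos hγ hc
      linarith
  have := mul_nonneg hα (neg_nonneg.2 ha)
  have := mul_nonneg hβ (neg_nonneg.2 hb)
  linarith

lemma disjoint_segment_of_opposite_sides {p q z w : ℝ × ℝ} (hpq : p ≠ q)
    (hz : 0 < orient p q z) (hw : orient p q w < 0) :
    Disjoint (segment ℝ q z) (segment ℝ p w) := by
  rw [Set.disjoint_left]
  rintro y ⟨α, β, hα, hβ, hαβ, rfl⟩ ⟨γ, δ, hγ, hδ, hγδ, h⟩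
  have h1 := orient_add_smul p q q z hαβ
  have h2 := orient_add_smul p q p w hγδ
  rw [h, h1] at h2
  simp only [orient_self_right, orient_self_left, mul_zero, zero_add] at h2
  have h3 := mul_nonneg hβ hz.le
  have h4 := mul_nonneg hδ (neg_nonneg.2 hw.le)
  have h5 : β = 0 := (mul_eq_zero.1 (by linarith : β * orient p q z = 0)).resolve_right hz.ne'
  have h6 : δ = 0 := (mul_eq_zero.1 (by linarith : δ * orient p q w = 0)).resolve_right hw.ne
  subst h5 h6
  rw [add_zero] at hαβ hγδ
  subst hαβ hγδ
  simp at h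
  exact hpq h

lemma eq_of_mem_segment_of_mem_segment {a b c z : ℝ × ℝ} (h : orient a b c ≠ 0)
    (hb : z ∈ segment ℝ a b) (hc : z ∈ segment ℝ a c) : z = a := by
  obtain ⟨α, β, hα, hβ, hαβ, rfl⟩ := hb
  obtain ⟨γ, δ, hγ, hδ, hγδ, hz⟩ := hc
  have h1 := orient_add_smul a b a b hαβ
  have h2 := orient_add_smul a b a c hγδ
  rw [hz, h1] at h2
  simp only [orient_self_right, orient_self_left, mul_zero, zero_add] at h2
  have hδ0 : δ = 0 := (mul_eq_zero.1 h2.symm).resolve_right h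
  subst hδ0
  rw [← hz]
  simp [show γ = 1 by linarith]

lemma orient_trans {p q a b c : ℝ × ℝ} (ha : 0 < orient p q a) (hb : 0 < orient p q b)
    (hc : 0 < orient p q c) (hab : 0 < orient p a b) (hbc : 0 < orient p b c) :
    0 < orient p a c := by
  have key : orient p q b * orient p a c = orient p q c * orient p a b
      + orient p q a * orient p b c := by
    unfold orient; ring
  have h1 := mul_pos hc hab
  have h2 := mul_pos ha hbc
  exact pos_of_mul_pos_right (key ▸ add_pos h1 h2) hb.le

/-- `v` is the first point of `X` after `u` in counterclockwise order around `p`, at an angle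
of less than `π` from `u`. -/
def IsNext (X : Finset (ℝ × ℝ)) (p u v : ℝ × ℝ) : Prop :=
  v ∈ X ∧ 0 < orient p u v ∧ ∀ z ∈ X, 0 < orient p u z → z = v ∨ 0 < orient p v z

namespace IsNext

variable {X : Finset (ℝ × ℝ)} {p u v u' v' : ℝ × ℝ}

lemma mem (h : IsNext X p u v) : v ∈ X := h.1

lemma ne_left (h : IsNext X p u v) : v ≠ p := by
  rintro rfl
  simpa using h.2.1

lemma ne_right (h : IsNext X p u v) : v ≠ u := by
  rintro rfl
  simpa using h.2.1

lemma not_between (h : IsNext X p u v) {z : ℝ × ℝ} (hz : z ∈ X) (huz : 0 < orient p u z) :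
    ¬ 0 < orient p z v := by
  intro hzv
  rcases h.2.2 z hz huz with rfl | hvz
  · simp at hzv
  · rw [orient_swap] at hvz; linarith

lemma disjoint_spoke (h : IsNext X p u v) (hgen : GeneralPosition X) (hp : p ∈ X) (hu : u ∈ X)
    (hup : u ≠ p) {z : ℝ × ℝ} (hz : z ∈ X) (hzp : z ≠ p) (hzu : z ≠ u) (hzv : z ≠ v) :
    Disjoint (segment ℝ v u) (segment ℝ z p) := by
  have huv := h.2.1
  have h1 := hgen.orient_ne_zero hp hu hz hup.symm hzp.symm hzu.symm
  have h2 := hgen.orient_ne_zero hp hz h.mem hzp.symm h.ne_left.symm hzv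
  rcases h1.lt_or_gt with h1 | h1 <;> rcases h2.lt_or_gt with h2 | h2
  · have key : orient u v z = orient p u v - orient p z v - orient p u z := by
      unfold orient; ring
    refine disjoint_segment_of_orient (u := u) (v := v) (by simp) (by simp) (by linarith) ?_
    rwa [orient_rotate]
  · refine (disjoint_segment_of_orient (u := p) (v := z) (by simp) (by simp) h2 ?_).symm
    rw [orient_swap]; linarith
  · refine (disjoint_segment_of_orient (u := z) (v := p) (by simp) (by simp) ?_ ?_).symm
    · rw [orient_swap_left]; linarith
    · rw [orient_swap_left, orient_swap]; linarith
  · exact absurd h2 (h.not_between hz h1)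

lemma disjoint_spokes_of_orient_pos (h : IsNext X p u v) (h' : IsNext X p u' v')
    (hgen : GeneralPosition X) (hp : p ∈ X) (hu' : u' ∈ X) (hup : u' ≠ p) (hvu' : v ≠ u')
    (hvv' : 0 < orient p v v') : Disjoint (segment ℝ v u) (segment ℝ v' u') := by
  have huv := h.2.1
  have h1 : orient p u' v ≤ 0 := not_lt.1 fun h1 => h'.not_between h.mem h1 hvv'
  have h2 := hgen.orient_ne_zero hp h.mem hu' h.ne_left.symm hup.symm hvu'
  refine disjoint_segment_of_orient (u := p) (v := v) (by simp) ?_ hvv' ?_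
  · rw [orient_swap]; linarith
  · rw [orient_swap] at h1
    exact lt_of_le_of_ne (by linarith) h2.symm

lemma disjoint_spokes (h : IsNext X p u v) (h' : IsNext X p u' v') (hgen : GeneralPosition X)
    (hp : p ∈ X) (hu : u ∈ X) (hup : u ≠ p) (hu' : u' ∈ X) (hup' : u' ≠ p)
    (hvu' : v ≠ u') (hvu : v' ≠ u) (hvv' : v ≠ v') :
    Disjoint (segment ℝ v u) (segment ℝ v' u') := by
  rcases (hgen.orient_ne_zero hp h.mem h'.mem h.ne_left.symm h'.ne_left.symm hvv').lt_or_gt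
    with h1 | h1
  · refine (h'.disjoint_spokes_of_orient_pos h hgen hp hu hup hvu ?_).symm
    rw [orient_swap]; linarith
  · exact h.disjoint_spokes_of_orient_pos h' hgen hp hu' hup' hvu' h1

lemma next_ne (h : IsNext X p u v) (h' : IsNext X p u' v') (hgen : GeneralPosition X)
    (hp : p ∈ X) (hu : u ∈ X) (hu' : u' ∈ X) (hup : u ≠ p) (hup' : u' ≠ p) (huu' : u ≠ u') :
    v ≠ v' := by
  rintro rfl
  rcases (hgen.orient_ne_zero hp hu hu' hup.symm hup'.symm huu').lt_or_gt with h1 | h1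
  · refine h'.not_between hu ?_ h.2.1
    rw [orient_swap]; linarith
  · exact h.not_between hu' h1 h'.2.1

lemma not_swap (h : IsNext X p u v) (h' : IsNext X p v u) : False := by
  have h1 := h.2.1
  have h2 := h'.2.1
  rw [orient_swap] at h2
  linarith

end IsNext

/-- `x` lists the points of `X` other than `p` and `q`, with inverse `rk`, in an order in which
the star at `p` can be turned into the star at `q`; the detour that replaces the edge `pq` takes
place at position `J`. -/
structure IsArcOrder (X : Finset (ℝ × ℝ)) (p q : ℝ × ℝ) (x : ℕ → ℝ × ℝ) (rk : ℝ × ℝ → ℕ)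
    (J : ℕ) : Prop where
  left_mem : p ∈ X
  right_mem : q ∈ X
  ne : p ≠ q
  six_le : 6 ≤ X.card
  mem : ∀ k < X.card - 2, x k ∈ X
  ne_left : ∀ k < X.card - 2, x k ≠ p
  ne_right : ∀ k < X.card - 2, x k ≠ q
  rank_apply : ∀ k < X.card - 2, rk (x k) = k
  rank_lt : ∀ z ∈ X, z ≠ p → z ≠ q → rk z < X.card - 2
  apply_rank : ∀ z ∈ X, z ≠ p → z ≠ q → x (rk z) = z
  disjoint : ∀ z ∈ X, z ≠ p → z ≠ q → ∀ w ∈ X, w ≠ p → w ≠ q → rk z < rk w →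
    Disjoint (segment ℝ z q) (segment ℝ w p)
  first : ∀ z ∈ X, 0 < orient p q z → IsNext X p q (x 0)
  last : ∀ z ∈ X, 0 < orient q p z → IsNext X q p (x (X.card - 3))
  detour : J = 1 ∧ 0 < orient p q (x J) ∨ J = 2 ∧ orient p q (x J) < 0

lemma exists_rank_of_strict_total {α : Type*} [Inhabited α] (s : Finset α) (R : α → α → Prop)
    (hirr : ∀ a ∈ s, ¬ R a a) (htrans : ∀ a ∈ s, ∀ b ∈ s, ∀ c ∈ s, R a b → R b c → R a c)
    (htotal : ∀ a ∈ s, ∀ b ∈ s, a ≠ b → R a b ∨ R b a) :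
    ∃ (x : ℕ → α) (rk : α → ℕ), (∀ k < s.card, x k ∈ s ∧ rk (x k) = k) ∧
      (∀ a ∈ s, rk a < s.card ∧ x (rk a) = a) ∧ ∀ a ∈ s, ∀ b ∈ s, rk a < rk b ↔ R a b := by
  classical
  let rk : α → ℕ := fun a => (s.filter fun b => R b a).card
  have hlt : ∀ a ∈ s, rk a < s.card := fun a ha =>
    Finset.card_lt_card (Finset.filter_ssubset.2 ⟨a, ha, hirr a ha⟩)
  have hmono : ∀ a ∈ s, ∀ b ∈ s, R a b → rk a < rk b := by
    intro a ha b hb hab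
    refine Finset.card_lt_card ((Finset.ssubset_iff_of_subset ?_).2 ⟨a, ?_, ?_⟩)
    · intro c hc
      rw [Finset.mem_filter] at hc ⊢
      exact ⟨hc.1, htrans c hc.1 a ha b hb hc.2 hab⟩
    · simp [ha, hab]
    · simp [hirr a ha]
  have hinj : Set.InjOn rk s := by
    intro a ha b hb hab
    by_contra hne
    rcases htotal a ha b hb hne with h | h
    · exact (hmono a ha b hb h).ne hab
    · exact (hmono b hb a ha h).ne' hab
  have himage : s.image rk = Finset.range s.card := by
    refine Finset.eq_of_subset_of_card_le ?_ ?_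
    · intro k hk
      obtain ⟨a, ha, rfl⟩ := Finset.mem_image.1 hk
      exact Finset.mem_range.2 (hlt a ha)
    · rw [Finset.card_image_of_injOn hinj, Finset.card_range]
  have hsurj : ∀ k < s.card, ∃ a ∈ s, rk a = k := fun k hk =>
    Finset.mem_image.1 (himage ▸ Finset.mem_range.2 hk)
  choose! x hx hrk using hsurj
  refine ⟨x, rk, fun k hk => ⟨hx k hk, hrk k hk⟩, fun a ha => ⟨hlt a ha, ?_⟩, ?_⟩
  · exact hinj (hx _ (hlt a ha)) ha (hrk _ (hlt a ha))
  · intro a ha b hb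
    refine ⟨fun h => ?_, hmono a ha b hb⟩
    by_contra hR
    rcases eq_or_ne a b with rfl | hne
    · exact h.false
    · exact h.not_gt (hmono b hb a ha ((htotal a ha b hb hne).resolve_left hR))

lemma exists_isArcOrder {X : Finset (ℝ × ℝ)} (hX : 6 ≤ X.card) (hgen : GeneralPosition X)
    {p q : ℝ × ℝ} (hp : p ∈ X) (hq : q ∈ X) (hpq : p ≠ q) :
    ∃ x rk J, IsArcOrder X p q x rk J := by
  let s := (X.erase p).erase q
  have hs : ∀ {z}, z ∈ s ↔ z ∈ X ∧ z ≠ p ∧ z ≠ q := by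
    intro z; simp only [s, Finset.mem_erase]; tauto
  have hcard : s.card = X.card - 2 := by
    rw [Finset.card_erase_of_mem (Finset.mem_erase.2 ⟨hpq.symm, hq⟩), Finset.card_erase_of_mem hp]
    omega
  have hside : ∀ z ∈ s, orient p q z < 0 ∨ 0 < orient p q z := fun z hz =>
    (hgen.orient_ne_zero hp hq (hs.1 hz).1 hpq (hs.1 hz).2.1.symm (hs.1 hz).2.2.symm).lt_or_gt
  let R : ℝ × ℝ → ℝ × ℝ → Prop := fun a b =>
    (0 < orient p q a ∧ orient p q b < 0) ∨
    (0 < orient p q a ∧ 0 < orient p q b ∧ 0 < orient p a b) ∨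
    (orient p q a < 0 ∧ orient p q b < 0 ∧ 0 < orient q b a)
  have hirr : ∀ a ∈ s, ¬ R a a := by
    rintro a - (⟨h, h'⟩ | ⟨-, -, h⟩ | ⟨-, -, h⟩)
    · linarith
    · simp at h
    · simp at h
  have hqp : ∀ a, orient q p a = -orient p q a := fun a => orient_swap_left _ _ _
  have htrans : ∀ a ∈ s, ∀ b ∈ s, ∀ c ∈ s, R a b → R b c → R a c := by
    rintro a - b - c - (⟨h1, h2⟩ | ⟨h1, h2, h3⟩ | ⟨h1, h2, h3⟩)
      (⟨h4, h5⟩ | ⟨h4, h5, h6⟩ | ⟨h4, h5, h6⟩)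
    any_goals linarith
    · exact Or.inl ⟨h1, h5⟩
    · exact Or.inl ⟨h1, h5⟩
    · exact Or.inr (Or.inl ⟨h1, h5, orient_trans h1 h2 h5 h3 h6⟩)
    · refine Or.inr (Or.inr ⟨h1, h5, ?_⟩)
      exact orient_trans (q := p) (by rw [hqp]; linarith) (by rw [hqp]; linarith)
        (by rw [hqp]; linarith) h6 h3
  have htotal : ∀ a ∈ s, ∀ b ∈ s, a ≠ b → R a b ∨ R b a := by
    intro a ha b hb hab
    have hpab := hgen.orient_ne_zero hp (hs.1 ha).1 (hs.1 hb).1 (hs.1 ha).2.1.symm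
      (hs.1 hb).2.1.symm hab
    have hqab := hgen.orient_ne_zero hq (hs.1 ha).1 (hs.1 hb).1 (hs.1 ha).2.2.symm
      (hs.1 hb).2.2.symm hab
    have h1 := orient_swap p a b
    have h2 := orient_swap q a b
    rcases hside a ha with h3 | h3 <;> rcases hside b hb with h4 | h4
    · rcases hqab.lt_or_gt with h | h
      · exact Or.inl (Or.inr (Or.inr ⟨h3, h4, by linarith⟩))
      · exact Or.inr (Or.inr (Or.inr ⟨h4, h3, by linarith⟩))
    · exact Or.inr (Or.inl ⟨h4, h3⟩)
    · exact Or.inl (Or.inl ⟨h3, h4⟩)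
    · rcases hpab.lt_or_gt with h | h
      · exact Or.inr (Or.inr (Or.inl ⟨h4, h3, by linarith⟩))
      · exact Or.inl (Or.inr (Or.inl ⟨h3, h4, by linarith⟩))
  obtain ⟨x, rk, hx, hrk, hR⟩ := exists_rank_of_strict_total s R hirr htrans htotal
  rw [hcard] at hx hrk
  have hdetour : ∃ J, J = 1 ∧ 0 < orient p q (x J) ∨ J = 2 ∧ orient p q (x J) < 0 := by
    have hx1 := hx 1 (by omega)
    have hx2 := hx 2 (by omega)
    rcases hside _ hx1.1 with h1 | h1
    · rcases hside _ hx2.1 with h2 | h2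
      · exact ⟨2, Or.inr ⟨rfl, h2⟩⟩
      · have := (hR _ hx2.1 _ hx1.1).2 (Or.inl ⟨h2, h1⟩)
        omega
    · exact ⟨1, Or.inl ⟨rfl, h1⟩⟩
  obtain ⟨J, hJ⟩ := hdetour
  have hmax : ∀ z ∈ X, z ≠ p → z ≠ q → rk z < X.card - 2 ∧ x (rk z) = z :=
    fun z hz h1 h2 => hrk z (hs.2 ⟨hz, h1, h2⟩)
  refine ⟨x, rk, J, hp, hq, hpq, hX, fun k hk => (hs.1 (hx k hk).1).1,
    fun k hk => (hs.1 (hx k hk).1).2.1, fun k hk => (hs.1 (hx k hk).1).2.2,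
    fun k hk => (hx k hk).2, fun z hz h1 h2 => (hmax z hz h1 h2).1,
    fun z hz h1 h2 => (hmax z hz h1 h2).2, ?_, ?_, ?_, hJ⟩
  · intro z hz hzp hzq w hw hwp hwq hlt
    rcases (hR z (hs.2 ⟨hz, hzp, hzq⟩) w (hs.2 ⟨hw, hwp, hwq⟩)).1 hlt with
      ⟨h1, h2⟩ | ⟨h1, h2, h3⟩ | ⟨h1, h2, h3⟩
    · rw [segment_symm ℝ z q, segment_symm ℝ w p]
      exact disjoint_segment_of_opposite_sides hpq h1 h2
    · refine (disjoint_segment_of_orient (u := w) (v := p) (by simp) (by simp) ?_ ?_).symm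
      · rwa [orient_swap_left, orient_swap, neg_neg]
      · rwa [← orient_rotate]
    · refine disjoint_segment_of_orient (u := z) (v := q) (by simp) (by simp) ?_ ?_
      · rwa [← orient_rotate]
      · rw [← orient_rotate, hqp]
        linarith
  · intro z hz hpos
    have h0 := hx 0 (by omega)
    have hne : ∀ y, 0 < orient p q y → y ≠ p ∧ y ≠ q := by
      rintro y hy
      constructor <;> rintro rfl <;> simp at hy
    have hlt : ∀ y ∈ X, 0 < orient p q y → y = x 0 ∨ R (x 0) y := by
      intro y hy hpos
      have hys := hs.2 ⟨hy, hne y hpos⟩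
      rcases Nat.eq_zero_or_pos (rk y) with h | h
      · exact Or.inl (by rw [← h, (hrk y hys).2])
      · exact Or.inr ((hR _ h0.1 _ hys).1 (by omega))
    have h0pos : 0 < orient p q (x 0) := by
      rcases hlt z hz hpos with rfl | h | h | h
      · exact hpos
      · exact h.1
      · exact h.1
      · linarith
    refine ⟨(hs.1 h0.1).1, h0pos, fun y hy hpos => (hlt y hy hpos).imp_right ?_⟩
    rintro (h | h | h)
    · linarith
    · exact h.2.2
    · linarith
  · intro z hz hpos
    have h0 := hx (X.card - 3) (by omega)
    have hne : ∀ y, 0 < orient q p y → y ≠ p ∧ y ≠ q := by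
      rintro y hy
      constructor <;> rintro rfl <;> simp at hy
    have hlt : ∀ y ∈ X, 0 < orient q p y → y = x (X.card - 3) ∨ R y (x (X.card - 3)) := by
      intro y hy hpos
      have hys := hs.2 ⟨hy, hne y hpos⟩
      rcases eq_or_ne (rk y) (X.card - 3) with h | h
      · exact Or.inl (by rw [← h, (hrk y hys).2])
      · refine Or.inr ((hR _ hys _ h0.1).1 ?_)
        have := (hrk y hys).1
        omega
    simp only [hqp] at hlt hpos ⊢
    have h0neg : 0 < -orient p q (x (X.card - 3)) := by
      rcases hlt z hz hpos with h | h | h | h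
      · rwa [← h]
      · linarith
      · linarith
      · linarith
    refine ⟨(hs.1 h0.1).1, by rw [hqp]; exact h0neg, fun y hy hpos => ?_⟩
    rw [hqp] at hpos
    refine (hlt y hy hpos).imp_right ?_
    rintro (h | h | h)
    · linarith
    · linarith
    · exact h.2.2

/-- The set of edges joining each vertex other than the root `ρ` to its parent. -/
def parentTree {α : Type*} [DecidableEq α] (X : Finset α) (ρ : α) (par : α → α) :
    Finset (Sym2 α) :=
  (X.erase ρ).image fun z => s(z, par z)

/-- The vertex `v` has at least two neighbours in `T`. -/
def IsInternal {α : Type*} (T : Finset (Sym2 α)) (v : α) : Prop :=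
  ∃ a b, a ≠ b ∧ s(v, a) ∈ T ∧ s(v, b) ∈ T

/-- The vertex `v` has at least three neighbours in `T`. -/
def IsBranching {α : Type*} (T : Finset (Sym2 α)) (v : α) : Prop :=
  ∃ a b c, a ≠ b ∧ a ≠ c ∧ b ≠ c ∧ s(v, a) ∈ T ∧ s(v, b) ∈ T ∧ s(v, c) ∈ T

/-- The tree `T'` arises from `T` by a flip that inserts `f`. -/
def IsFlip {α : Type*} [DecidableEq α] (T : Finset (Sym2 α)) (f : Sym2 α)
    (T' : Finset (Sym2 α)) : Prop :=
  f ∉ T ∧ ∃ e ∈ T, T' = insert f (T.erase e)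

section ParentTree

variable {α : Type*} [DecidableEq α] {X : Finset α} {ρ : α} {par : α → α}

lemma mem_parentTree {e : Sym2 α} :
    e ∈ parentTree X ρ par ↔ ∃ z ∈ X, z ≠ ρ ∧ s(z, par z) = e := by
  simp only [parentTree, Finset.mem_image, Finset.mem_erase]
  grind

lemma mk_mem_parentTree {a b : α} : s(a, b) ∈ parentTree X ρ par ↔
    (a ∈ X ∧ a ≠ ρ ∧ par a = b) ∨ (b ∈ X ∧ b ≠ ρ ∧ par b = a) := by
  simp only [mem_parentTree, Sym2.eq_iff]
  constructor
  · rintro ⟨z, hz, hzρ, ⟨rfl, rfl⟩ | ⟨rfl, rfl⟩⟩ <;> simp [hz, hzρ]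
  · rintro (⟨h1, h2, h3⟩ | ⟨h1, h2, h3⟩)
    · exact ⟨a, h1, h2, Or.inl ⟨rfl, h3⟩⟩
    · exact ⟨b, h1, h2, Or.inr ⟨rfl, h3⟩⟩

lemma card_parentTree (hρ : ρ ∈ X) (ht : α → ℕ)
    (hht : ∀ z ∈ X, z ≠ ρ → ht (par z) < ht z) : (parentTree X ρ par).card = X.card - 1 := by
  rw [parentTree, Finset.card_image_of_injOn, Finset.card_erase_of_mem hρ]
  intro z hz w hw hzw
  simp only [Finset.coe_erase, Set.mem_sdiff, Finset.mem_coe, Set.mem_singleton_iff] at hz hw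
  rcases Sym2.eq_iff.1 hzw with ⟨h, -⟩ | ⟨h1, h2⟩
  · exact h
  · have h3 := hht z hz.1 hz.2
    have h4 := hht w hw.1 hw.2
    rw [h2] at h3
    rw [← h1] at h4
    omega

lemma reflTransGen_parentTree (ht : α → ℕ) (hmaps : ∀ z ∈ X, z ≠ ρ → par z ∈ X)
    (hht : ∀ z ∈ X, z ≠ ρ → ht (par z) < ht z) {a b : α} (ha : a ∈ X) (hb : b ∈ X) :
    Relation.ReflTransGen (fun a b => s(a, b) ∈ parentTree X ρ par) a b := by
  have hsymm : Std.Symm (fun a b => s(a, b) ∈ parentTree X ρ par) :=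
    ⟨fun a b h => by rwa [Sym2.eq_swap]⟩
  have hroot : ∀ n, ∀ z ∈ X, ht z = n →
      Relation.ReflTransGen (fun a b => s(a, b) ∈ parentTree X ρ par) z ρ := by
    intro n
    induction n using Nat.strong_induction_on with
    | _ n ih =>
      intro z hz hn
      by_cases hzρ : z = ρ
      · exact hzρ ▸ Relation.ReflTransGen.refl
      · exact .head (mem_parentTree.2 ⟨z, hz, hzρ, rfl⟩)
          (ih _ (hn ▸ hht z hz hzρ) _ (hmaps z hz hzρ) rfl)
  exact (hroot _ a ha rfl).trans (Std.Symm.symm _ _ (hroot _ b hb rfl))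

lemma IsInternal.eq_root_or_exists {v : α} (h : IsInternal (parentTree X ρ par) v) :
    v = ρ ∨ ∃ a ∈ X, a ≠ ρ ∧ par a = v := by
  obtain ⟨a, b, hab, ha, hb⟩ := h
  rw [mk_mem_parentTree] at ha hb
  grind

lemma isFlip_of_card_eq {T T' : Finset (Sym2 α)} {f : Sym2 α} (hcard : T.card = T'.card)
    (hf : f ∉ T) (hf' : f ∈ T') (hsub : T' ⊆ insert f T) : IsFlip T f T' := by
  refine ⟨hf, ?_⟩
  have h1 : T'.erase f ⊆ T := by
    intro e he
    rw [Finset.mem_erase] at he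
    exact (Finset.mem_insert.1 (hsub he.2)).resolve_left he.1
  have h2 : (T \ T'.erase f).card = 1 := by
    have := Finset.card_pos.2 ⟨f, hf'⟩
    rw [Finset.card_sdiff_of_subset h1, Finset.card_erase_of_mem hf']
    omega
  obtain ⟨e, he⟩ := Finset.card_eq_one.1 h2
  have heT : e ∈ T \ T'.erase f := he ▸ Finset.mem_singleton_self e
  refine ⟨e, (Finset.mem_sdiff.1 heT).1, ?_⟩
  rw [Finset.erase_eq, ← he, Finset.sdiff_sdiff_eq_self h1, Finset.insert_erase hf']

end ParentTree

lemma isPlaneSpanningTree_parentTree {X : Finset (ℝ × ℝ)} (hgen : GeneralPosition X)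
    {ρ : ℝ × ℝ} {par : ℝ × ℝ → ℝ × ℝ} (hρ : ρ ∈ X) (ht : ℝ × ℝ → ℕ)
    (hmaps : ∀ z ∈ X, z ≠ ρ → par z ∈ X) (hht : ∀ z ∈ X, z ≠ ρ → ht (par z) < ht z)
    (hdisj : ∀ z ∈ X, z ≠ ρ → ∀ w ∈ X, w ≠ ρ → z ≠ w → par z ≠ par w → par z ≠ w → par w ≠ z →
      Disjoint (segment ℝ z (par z)) (segment ℝ w (par w))) :
    IsPlaneSpanningTree X (parentTree X ρ par) := by
  have hne : ∀ z ∈ X, z ≠ ρ → z ≠ par z := fun z hz hzρ h => (hht z hz hzρ).ne (by rw [← h])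
  have hpath : ∀ {a b c v : ℝ × ℝ}, a ∈ X → b ∈ X → c ∈ X → a ≠ b → a ≠ c → b ≠ c →
      v ∈ segment ℝ a b → v ∈ segment ℝ a c → v = a := fun ha hb hc hab hac hbc =>
    eq_of_mem_segment_of_mem_segment (hgen.orient_ne_zero ha hb hc hab hac hbc)
  refine ⟨?_, card_parentTree hρ ht hht,
    fun a ha b hb => reflTransGen_parentTree ht hmaps hht ha hb,
    ?_⟩
  · intro e he
    obtain ⟨z, hz, hzρ, rfl⟩ := mem_parentTree.1 he
    exact ⟨z, par z, rfl, hne z hz hzρ, hz, hmaps z hz hzρ⟩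
  · intro e he f hf hef v hve hvf
    obtain ⟨z, hz, hzρ, rfl⟩ := mem_parentTree.1 he
    obtain ⟨w, hw, hwρ, rfl⟩ := mem_parentTree.1 hf
    have hzw : z ≠ w := by rintro rfl; exact hef rfl
    have hz' := hmaps z hz hzρ
    have hw' := hmaps w hw hwρ
    change v ∈ segment ℝ z (par z) at hve
    change v ∈ segment ℝ w (par w) at hvf
    by_cases h1 : par z = par w
    · rw [segment_symm] at hve hvf
      rw [← h1] at hvf
      have := hpath hz' hz hw (hne z hz hzρ).symm (h1 ▸ (hne w hw hwρ).symm) hzw hve hvf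
      simp [this, h1]
    by_cases h2 : par z = w
    · subst h2
      rw [segment_symm] at hve
      have hzw' : z ≠ par (par z) := by
        intro h
        have := hht z hz hzρ
        have := hht _ hw hwρ
        rw [← h] at this
        omega
      have := hpath hz' hz hw' hzw.symm h1 hzw' hve hvf
      simp [this]
    by_cases h3 : par w = z
    · subst h3
      rw [segment_symm] at hvf
      have := hpath hw' hz' hw (hne _ hz hzρ) hzw h2 hve hvf
      simp [this]
    · exact absurd hvf (Set.disjoint_left.1 (hdisj z hz hzρ w hw hwρ hzw h1 h2 h3) hve)

/-- The star with centre `p`. -/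
def starTree {α : Type*} [DecidableEq α] (X : Finset α) (p : α) : Finset (Sym2 α) :=
  parentTree X p fun _ => p

/-- The tree on the way from the star at `p` to the star at `q` in which the `K` points of rank
less than `K` are attached to `q`. -/
def doubleStar {α : Type*} [DecidableEq α] (X : Finset α) (p q : α) (rk : α → ℕ) (K : ℕ) :
    Finset (Sym2 α) :=
  parentTree X p fun z => if z = q then p else if rk z < K then q else p

/-- The tree on the way from the star at `p` to the star at `q` in which the `J` points of rank
less than `J` are attached to `q`, and the edge `pq` is replaced by the path via `u`, the point of
rank `J`. -/
def detourTree {α : Type*} [DecidableEq α] (X : Finset α) (p q u : α) (rk : α → ℕ) (J : ℕ) :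
    Finset (Sym2 α) :=
  parentTree X p fun z => if z = q then u else if rk z < J then q else p

/-- The star with centre `p`, with `y` reattached to `o` and `w` reattached to `s`. -/
def bypassTree {α : Type*} [DecidableEq α] (X : Finset α) (o p s y w : α) : Finset (Sym2 α) :=
  parentTree X p fun z => if z = y then o else if z = w then s else p

lemma isPlaneSpanningTree_starTree {X : Finset (ℝ × ℝ)} (hgen : GeneralPosition X) {p : ℝ × ℝ}
    (hp : p ∈ X) : IsPlaneSpanningTree X (starTree X p) :=
  isPlaneSpanningTree_parentTree hgen hp (fun z => if z = p then 0 else 1) (fun _ _ _ => hp)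
    (by grind) (by grind)

section ArcOrder

variable {X : Finset (ℝ × ℝ)} {p q : ℝ × ℝ} {x : ℕ → ℝ × ℝ} {rk : ℝ × ℝ → ℕ} {J : ℕ}

namespace IsArcOrder

lemma detour_eq (h : IsArcOrder X p q x rk J) : J = 1 ∨ J = 2 :=
  h.detour.imp And.left And.left

lemma eq_apply (h : IsArcOrder X p q x rk J) {z : ℝ × ℝ} (hz : z ∈ X) (hzp : z ≠ p)
    (hzq : z ≠ q) {k : ℕ} (hk : rk z = k) : z = x k := by
  rw [← hk, h.apply_rank z hz hzp hzq]

lemma isPlaneSpanningTree_doubleStar (h : IsArcOrder X p q x rk J) (hgen : GeneralPosition X)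
    (K : ℕ) : IsPlaneSpanningTree X (doubleStar X p q rk K) := by
  have hp := h.left_mem
  have hq := h.right_mem
  have hpq := h.ne
  refine isPlaneSpanningTree_parentTree hgen h.left_mem
    (fun z => if z = p then 0 else if z = q then 1 else 2) (by grind) (by grind) ?_
  intro z hz hzp w hw hwp hzw
  by_cases hzq : z = q
  · grind
  by_cases hwq : w = q
  · grind
  by_cases h1 : rk z < K <;> by_cases h2 : rk w < K <;>
    simp only [hzq, hwq, h1, h2, if_true, if_false]
  · grind
  · intros
    exact h.disjoint z hz hzp hzq w hw hwp hwq (by omega)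
  · intros
    exact (h.disjoint w hw hwp hwq z hz hzp hzq (by omega)).symm
  · grind

lemma isPlaneSpanningTree_detourTree (h : IsArcOrder X p q x rk J) (hgen : GeneralPosition X) :
    IsPlaneSpanningTree X (detourTree X p q (x J) rk J) := by
  have hp := h.left_mem
  have hq := h.right_mem
  have hpq := h.ne
  have hJ : J < X.card - 2 := by have := h.six_le; have := h.detour_eq; omega
  have hx := h.mem J hJ
  have hxp := h.ne_left J hJ
  have hxq := h.ne_right J hJ
  have hrx := h.rank_apply J hJ
  refine isPlaneSpanningTree_parentTree hgen h.left_mem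
    (fun z => if z = p then 0 else if z = x J then 1 else if z = q then 2 else 3)
    (by grind) (by grind) ?_
  intro z hz hzp w hw hwp hzw
  have key : ∀ z ∈ X, z ≠ p → z ≠ q → z ≠ x J → ¬ rk z < J →
      Disjoint (segment ℝ q (x J)) (segment ℝ z p) := by
    intro z hz hzp hzq hzx hzJ
    rw [segment_symm]
    refine h.disjoint _ hx hxp hxq z hz hzp hzq ?_
    rw [hrx]
    by_contra hlt
    exact hzx (h.eq_apply hz hzp hzq (by omega))
  by_cases hzq : z = q
  · subst hzq
    by_cases h1 : rk w < J <;> simp only [hzw.symm, h1, if_true, if_false]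
    · grind
    · intro _ h2 _
      exact key w hw hwp hzw.symm h2.symm h1
  by_cases hwq : w = q
  · subst hwq
    by_cases h1 : rk z < J <;> simp only [hzq, h1, if_true, if_false]
    · grind
    · intro _ _ h2
      exact (key z hz hzp hzq h2.symm h1).symm
  by_cases h1 : rk z < J <;> by_cases h2 : rk w < J <;>
    simp only [hzq, hwq, h1, h2, if_true, if_false]
  · grind
  · intros
    exact h.disjoint z hz hzp hzq w hw hwp hwq (by omega)
  · intros
    exact (h.disjoint w hw hwp hwq z hz hzp hzq (by omega)).symm
  · grind

end IsArcOrder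

/-- The data needed to bypass the star at `p` between the arcs `op` and `ps`. -/
structure IsBypass (X : Finset (ℝ × ℝ)) (o p s y w : ℝ × ℝ) : Prop where
  center_mem : p ∈ X
  left_mem : o ∈ X
  right_mem : s ∈ X
  left_ne_center : o ≠ p
  right_ne_center : s ≠ p
  left_ne_right : o ≠ s
  next_left : IsNext X p o y
  next_right : IsNext X p s w

namespace IsBypass

variable {o s y w : ℝ × ℝ}

lemma ne (h : IsBypass X o p s y w) (hgen : GeneralPosition X) : y ≠ w :=
  h.next_left.next_ne h.next_right hgen h.center_mem h.left_mem h.right_mem h.left_ne_center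
    h.right_ne_center h.left_ne_right

lemma not_swap (h : IsBypass X o p s y w) (hy : y = s) (hw : w = o) : False :=
  (hy ▸ h.next_left).not_swap (hw ▸ h.next_right)

lemma isPlaneSpanningTree (h : IsBypass X o p s y w) (hgen : GeneralPosition X) :
    IsPlaneSpanningTree X (bypassTree X o p s y w) := by
  have hp := h.center_mem
  have ho := h.left_mem
  have hs := h.right_mem
  have hop := h.left_ne_center
  have hsp := h.right_ne_center
  have hos := h.left_ne_right
  have hyw := h.ne hgen
  have hy := h.next_left.ne_right
  have hw := h.next_right.ne_right
  have hswap := h.not_swap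
  have hyp := h.next_left.ne_left
  have hwp := h.next_right.ne_left
  refine isPlaneSpanningTree_parentTree hgen hp
    (fun z => if z = p then 0 else if z = y then (if o = w then 3 else 2) else
      if z = w then (if s = y then 3 else 2) else 1) (by grind) (by grind) ?_
  intro a ha hap b hb hbp hab
  have key1 : ∀ z ∈ X, z ≠ p → z ≠ o → z ≠ y → Disjoint (segment ℝ y o) (segment ℝ z p) :=
    fun z hz hzp hzo hzy => h.next_left.disjoint_spoke hgen hp ho hop hz hzp hzo hzy
  have key2 : ∀ z ∈ X, z ≠ p → z ≠ s → z ≠ w → Disjoint (segment ℝ w s) (segment ℝ z p) :=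
    fun z hz hzp hzs hzw => h.next_right.disjoint_spoke hgen hp hs hsp hz hzp hzs hzw
  have key3 : y ≠ s → w ≠ o → Disjoint (segment ℝ y o) (segment ℝ w s) := fun h1 h2 =>
    h.next_left.disjoint_spokes h.next_right hgen hp ho hop hs hsp h1 h2 hyw
  by_cases hay : a = y
  · subst hay
    by_cases hbw : b = w
    · subst hbw
      simp only [hab.symm, if_true, if_false]
      grind
    · simp only [hab.symm, hbw, if_true, if_false]
      grind
  by_cases haw : a = w
  · subst haw
    by_cases hby : b = y
    · subst hby
      simp only [hay, if_true, if_false]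
      intro _ h1 h2
      exact (key3 h1.symm h2.symm).symm
    · simp only [hab.symm, hby, hay, if_true, if_false]
      grind
  simp only [hay, haw, if_false]
  by_cases hby : b = y
  · subst hby
    simp only [if_true]
    intro _ _ h1
    exact (key1 a ha hap h1.symm hay).symm
  by_cases hbw : b = w
  · subst hbw
    simp only [hby, if_true, if_false]
    intro _ _ h1
    exact (key2 a ha hap h1.symm haw).symm
  · grind

end IsBypass

end ArcOrder

section Flip

variable {X : Finset (ℝ × ℝ)} {p q : ℝ × ℝ} {x : ℕ → ℝ × ℝ} {rk : ℝ × ℝ → ℕ} {J : ℕ}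

lemma IsPlaneSpanningTree.isFlip {T T' : Finset (Sym2 (ℝ × ℝ))} {f : Sym2 (ℝ × ℝ)}
    (h : IsPlaneSpanningTree X T) (h' : IsPlaneSpanningTree X T') (hf : f ∉ T) (hf' : f ∈ T')
    (hsub : T' ⊆ insert f T) : IsFlip T f T' :=
  isFlip_of_card_eq (h.2.1.trans h'.2.1.symm) hf hf' hsub

namespace IsArcOrder

lemma doubleStar_zero : doubleStar X p q rk 0 = starTree X p := by
  simp [doubleStar, starTree]

lemma mem_doubleStar (h : IsArcOrder X p q x rk J) {e : Sym2 (ℝ × ℝ)} {K : ℕ} :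
    e ∈ doubleStar X p q rk K ↔
      e = s(p, q) ∨ ∃ z ∈ X, z ≠ p ∧ z ≠ q ∧ (rk z < K ∧ e = s(q, z) ∨ K ≤ rk z ∧ e = s(p, z)) := by
  have := h.left_mem
  have := h.right_mem
  have := h.ne
  rw [doubleStar, mem_parentTree]
  constructor
  · rintro ⟨z, hz, hzp, rfl⟩
    grind [Sym2.eq_swap]
  · rintro (rfl | ⟨z, hz, hzp, hzq, ⟨hK, rfl⟩ | ⟨hK, rfl⟩⟩)
    · exact ⟨q, h.right_mem, h.ne.symm, by simp [Sym2.eq_swap]⟩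
    · exact ⟨z, hz, hzp, by simp [hzq, hK, Sym2.eq_swap]⟩
    · exact ⟨z, hz, hzp, by simp [hzq, hK.not_gt, Sym2.eq_swap]⟩

lemma mem_detourTree (h : IsArcOrder X p q x rk J) {e : Sym2 (ℝ × ℝ)} :
    e ∈ detourTree X p q (x J) rk J ↔ e = s(q, x J) ∨
      ∃ z ∈ X, z ≠ p ∧ z ≠ q ∧ (rk z < J ∧ e = s(q, z) ∨ J ≤ rk z ∧ e = s(p, z)) := by
  have := h.left_mem
  have := h.right_mem
  have := h.ne
  rw [detourTree, mem_parentTree]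
  constructor
  · rintro ⟨z, hz, hzp, rfl⟩
    grind [Sym2.eq_swap]
  · rintro (rfl | ⟨z, hz, hzp, hzq, ⟨hK, rfl⟩ | ⟨hK, rfl⟩⟩)
    · exact ⟨q, h.right_mem, h.ne.symm, by simp⟩
    · exact ⟨z, hz, hzp, by simp [hzq, hK, Sym2.eq_swap]⟩
    · exact ⟨z, hz, hzp, by simp [hzq, hK.not_gt, Sym2.eq_swap]⟩

lemma doubleStar_card (h : IsArcOrder X p q x rk J) :
    doubleStar X p q rk (X.card - 2) = starTree X q := by
  ext e
  rw [h.mem_doubleStar, starTree, mem_parentTree]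
  constructor
  · rintro (rfl | ⟨z, hz, hzp, hzq, ⟨-, rfl⟩ | ⟨hK, -⟩⟩)
    · exact ⟨p, h.left_mem, h.ne, rfl⟩
    · exact ⟨z, hz, hzq, Sym2.eq_swap⟩
    · exact absurd (h.rank_lt z hz hzp hzq) hK.not_gt
  · rintro ⟨z, hz, hzq, rfl⟩
    by_cases hzp : z = p
    · exact Or.inl (by rw [hzp])
    · exact Or.inr ⟨z, hz, hzp, hzq, Or.inl ⟨h.rank_lt z hz hzp hzq, Sym2.eq_swap⟩⟩

lemma apply_notMem_doubleStar (h : IsArcOrder X p q x rk J) {k K : ℕ} (hk : k < X.card - 2)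
    (hK : K ≤ k) : s(q, x k) ∉ doubleStar X p q rk K := by
  have h1 := h.ne_left k hk
  have h2 := h.ne_right k hk
  have h3 := h.rank_apply k hk
  have h4 := h.ne
  rw [h.mem_doubleStar]
  simp only [Sym2.eq_iff]
  grind

lemma apply_mem_doubleStar (h : IsArcOrder X p q x rk J) {k K : ℕ} (hk : k < X.card - 2)
    (hK : k < K) : s(q, x k) ∈ doubleStar X p q rk K :=
  h.mem_doubleStar.2 <| Or.inr ⟨x k, h.mem k hk, h.ne_left k hk, h.ne_right k hk,
    Or.inl ⟨by rwa [h.rank_apply k hk], rfl⟩⟩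

lemma notMem_detourTree (h : IsArcOrder X p q x rk J) (hJ : J < X.card - 2) :
    s(p, q) ∉ detourTree X p q (x J) rk J := by
  have h1 := h.ne_left J hJ
  have h2 := h.ne_right J hJ
  have h4 := h.ne
  rw [h.mem_detourTree]
  simp only [Sym2.eq_iff]
  grind

lemma isFlip_doubleStar (h : IsArcOrder X p q x rk J) (hgen : GeneralPosition X) {K : ℕ}
    (hK : K < X.card - 2) :
    IsFlip (doubleStar X p q rk K) s(q, x K) (doubleStar X p q rk (K + 1)) := by
  refine (h.isPlaneSpanningTree_doubleStar hgen K).isFlip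
    (h.isPlaneSpanningTree_doubleStar hgen (K + 1)) (h.apply_notMem_doubleStar hK le_rfl)
    (h.apply_mem_doubleStar hK K.lt_succ_self) ?_
  intro e he
  rw [Finset.mem_insert, h.mem_doubleStar]
  rw [h.mem_doubleStar] at he
  have := @h.eq_apply
  grind

lemma isFlip_doubleStar_detourTree (h : IsArcOrder X p q x rk J) (hgen : GeneralPosition X)
    (hJ : J < X.card - 2) :
    IsFlip (doubleStar X p q rk J) s(q, x J) (detourTree X p q (x J) rk J) := by
  refine (h.isPlaneSpanningTree_doubleStar hgen J).isFlip
    (h.isPlaneSpanningTree_detourTree hgen) (h.apply_notMem_doubleStar hJ le_rfl)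
    (h.mem_detourTree.2 (Or.inl rfl)) ?_
  intro e he
  rw [Finset.mem_insert, h.mem_doubleStar]
  rw [h.mem_detourTree] at he
  grind

lemma isFlip_detourTree_doubleStar (h : IsArcOrder X p q x rk J) (hgen : GeneralPosition X)
    (hJ : J < X.card - 2) :
    IsFlip (detourTree X p q (x J) rk J) s(p, q) (doubleStar X p q rk (J + 1)) := by
  refine (h.isPlaneSpanningTree_detourTree hgen).isFlip
    (h.isPlaneSpanningTree_doubleStar hgen (J + 1)) (h.notMem_detourTree hJ)
    (h.mem_doubleStar.2 (Or.inl rfl)) ?_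
  intro e he
  rw [Finset.mem_insert, h.mem_detourTree]
  rw [h.mem_doubleStar] at he
  have := @h.eq_apply
  grind

end IsArcOrder

variable {o s y w : ℝ × ℝ}

lemma mem_bypassTree {e : Sym2 (ℝ × ℝ)} (h : IsBypass X o p s y w) (hgen : GeneralPosition X) :
    e ∈ bypassTree X o p s y w ↔ e = s(o, y) ∨ e = s(s, w) ∨
      ∃ z ∈ X, z ≠ p ∧ z ≠ y ∧ z ≠ w ∧ e = s(p, z) := by
  have hyw := h.ne hgen
  rw [bypassTree, mem_parentTree]
  constructor
  · rintro ⟨z, hz, hzp, rfl⟩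
    grind [Sym2.eq_swap]
  · rintro (rfl | rfl | ⟨z, hz, hzp, hzq, hzw, rfl⟩)
    · exact ⟨y, h.next_left.mem, h.next_left.ne_left, by simp [Sym2.eq_swap]⟩
    · exact ⟨w, h.next_right.mem, h.next_right.ne_left, by simp [hyw.symm, Sym2.eq_swap]⟩
    · exact ⟨z, hz, hzp, by simp [hzq, hzw, Sym2.eq_swap]⟩

namespace IsBypass

lemma isFlip_doubleStar (h : IsBypass X o p q y (x 0)) (ha : IsArcOrder X p q x rk J)
    (hgen : GeneralPosition X) :
    IsFlip (bypassTree X o p q y (x 0)) s(p, y) (doubleStar X p q rk 1) := by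
  have := ha.six_le
  have hyp := h.next_left.ne_left
  have hyX := h.next_left.mem
  have hop := h.left_ne_center
  have hqp := h.right_ne_center
  have hyx := h.ne hgen
  have hr := ha.rank_apply 0 (by omega)
  have hxp := ha.ne_left 0 (by omega)
  refine (h.isPlaneSpanningTree hgen).isFlip (ha.isPlaneSpanningTree_doubleStar hgen 1) ?_ ?_ ?_
  · rw [mem_bypassTree h hgen]
    simp only [Sym2.eq_iff]
    grind
  · rw [ha.mem_doubleStar]
    have := @ha.eq_apply
    grind
  · intro e he
    rw [Finset.mem_insert, mem_bypassTree h hgen]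
    rw [ha.mem_doubleStar] at he
    have := @ha.eq_apply
    have := ha.right_mem
    have := h.next_right.ne_right
    grind

lemma isFlip_doubleStar_bypassTree (h : IsBypass X p q s (x (X.card - 3)) w)
    (ha : IsArcOrder X p q x rk J) (hgen : GeneralPosition X) :
    IsFlip (doubleStar X p q rk (X.card - 3)) s(s, w)
      (bypassTree X p q s (x (X.card - 3)) w) := by
  have := ha.six_le
  have hop := h.left_ne_center
  have hqp := h.right_ne_center
  have hyx := h.ne hgen
  have hwq := h.next_right.ne_left
  have hws := h.next_right.ne_right
  have hps := h.left_ne_right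
  have hr := ha.rank_apply (X.card - 3) (by omega)
  refine (ha.isPlaneSpanningTree_doubleStar hgen _).isFlip (h.isPlaneSpanningTree hgen) ?_ ?_ ?_
  · rw [ha.mem_doubleStar]
    simp only [Sym2.eq_iff]
    have := h.not_swap
    have := @ha.eq_apply
    have := @ha.rank_lt
    grind
  · exact (mem_bypassTree h hgen).2 (Or.inr (Or.inl rfl))
  · intro e he
    rw [Finset.mem_insert, ha.mem_doubleStar]
    rw [mem_bypassTree h hgen] at he
    have := @ha.eq_apply
    have := @ha.rank_lt
    have := h.next_left.mem
    have := h.next_left.ne_right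
    have := h.next_left.ne_left
    grind [Sym2.eq_swap]

end IsBypass

end Flip

section Degrees

variable {X : Finset (ℝ × ℝ)} {p q : ℝ × ℝ} {x : ℕ → ℝ × ℝ} {rk : ℝ × ℝ → ℕ} {J : ℕ}

lemma isInternal_starTree_iff (hX : 6 ≤ X.card) (hp : p ∈ X) {v : ℝ × ℝ} :
    IsInternal (starTree X p) v ↔ v = p := by
  constructor
  · intro h
    rcases h.eq_root_or_exists with h | ⟨-, -, -, h⟩
    · exact h
    · exact h.symm
  · rintro rfl
    have : 1 < (X.erase v).card := by rw [Finset.card_erase_of_mem hp]; omega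
    obtain ⟨a, ha, b, hb, hab⟩ := Finset.one_lt_card.1 this
    rw [Finset.mem_erase] at ha hb
    exact ⟨a, b, hab, mk_mem_parentTree.2 (Or.inr ⟨ha.2, ha.1, rfl⟩),
      mk_mem_parentTree.2 (Or.inr ⟨hb.2, hb.1, rfl⟩)⟩

namespace IsArcOrder

lemma isInternal_doubleStar_iff (h : IsArcOrder X p q x rk J) {K : ℕ} (hK : 0 < K)
    (hK' : K < X.card - 2) {v : ℝ × ℝ} :
    IsInternal (doubleStar X p q rk K) v ↔ v = p ∨ v = q := by
  constructor
  · intro hv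
    rcases hv.eq_root_or_exists with hv | ⟨z, -, -, rfl⟩
    · exact Or.inl hv
    · grind
  · rintro (rfl | rfl)
    · refine ⟨q, x K, (h.ne_right K hK').symm, h.mem_doubleStar.2 (Or.inl rfl),
        h.mem_doubleStar.2 <| Or.inr ⟨x K, h.mem K hK', h.ne_left K hK', h.ne_right K hK',
          Or.inr ⟨by rw [h.rank_apply K hK'], rfl⟩⟩⟩
    · exact ⟨p, x 0, (h.ne_left 0 (by omega)).symm, h.mem_doubleStar.2 (Or.inl Sym2.eq_swap),
        h.apply_mem_doubleStar (by omega) hK⟩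

lemma left_apply_mem_detourTree (h : IsArcOrder X p q x rk J) {k : ℕ} (hk : k < X.card - 2)
    (hJ : J ≤ k) : s(p, x k) ∈ detourTree X p q (x J) rk J :=
  h.mem_detourTree.2 <| Or.inr ⟨x k, h.mem k hk, h.ne_left k hk, h.ne_right k hk,
    Or.inr ⟨by rwa [h.rank_apply k hk], rfl⟩⟩

lemma right_apply_mem_detourTree (h : IsArcOrder X p q x rk J) {k : ℕ} (hk : k < X.card - 2)
    (hJ : k ≤ J) : s(q, x k) ∈ detourTree X p q (x J) rk J := by
  rcases hJ.eq_or_lt with rfl | hJ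
  · exact h.mem_detourTree.2 (Or.inl rfl)
  · exact h.mem_detourTree.2 <| Or.inr ⟨x k, h.mem k hk, h.ne_left k hk, h.ne_right k hk,
      Or.inl ⟨by rwa [h.rank_apply k hk], rfl⟩⟩

lemma apply_inj (h : IsArcOrder X p q x rk J) {k l : ℕ} (hk : k < X.card - 2)
    (hl : l < X.card - 2) (hkl : x k = x l) : k = l := by
  rw [← h.rank_apply k hk, ← h.rank_apply l hl, hkl]

lemma isInternal_detourTree_iff (h : IsArcOrder X p q x rk J) {v : ℝ × ℝ} :
    IsInternal (detourTree X p q (x J) rk J) v ↔ v = p ∨ v = q ∨ v = x J := by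
  have hX := h.six_le
  have hJ := h.detour_eq
  constructor
  · intro hv
    rcases hv.eq_root_or_exists with hv | ⟨z, -, -, rfl⟩
    · exact Or.inl hv
    · grind
  · rintro (rfl | rfl | rfl)
    · exact ⟨x J, x (J + 1), fun hx => by have := h.apply_inj (by omega) (by omega) hx; omega,
        h.left_apply_mem_detourTree (by omega) le_rfl,
        h.left_apply_mem_detourTree (by omega) J.le_succ⟩
    · exact ⟨x 0, x J, fun hx => by have := h.apply_inj (by omega) (by omega) hx; omega,
        h.right_apply_mem_detourTree (by omega) J.zero_le,
        h.right_apply_mem_detourTree (by omega) le_rfl⟩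
    · refine ⟨p, q, h.ne, ?_, ?_⟩
      · rw [Sym2.eq_swap]
        exact h.left_apply_mem_detourTree (by omega) le_rfl
      · rw [Sym2.eq_swap]
        exact h.right_apply_mem_detourTree (by omega) le_rfl

lemma isBranching_detourTree_left (h : IsArcOrder X p q x rk J) (hJ : J = 1) :
    IsBranching (detourTree X p q (x J) rk J) p := by
  have hX := h.six_le
  refine ⟨x 1, x 2, x 3, ?_, ?_, ?_, h.left_apply_mem_detourTree (by omega) (by omega),
    h.left_apply_mem_detourTree (by omega) (by omega),
    h.left_apply_mem_detourTree (by omega) (by omega)⟩ <;> intro hx <;>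
  · have := h.apply_inj (by omega) (by omega) hx
    omega

lemma isBranching_detourTree_right (h : IsArcOrder X p q x rk J) (hJ : J = 2) :
    IsBranching (detourTree X p q (x J) rk J) q := by
  have hX := h.six_le
  refine ⟨x 0, x 1, x 2, ?_, ?_, ?_, h.right_apply_mem_detourTree (by omega) (by omega),
    h.right_apply_mem_detourTree (by omega) (by omega),
    h.right_apply_mem_detourTree (by omega) (by omega)⟩ <;> intro hx <;>
  · have := h.apply_inj (by omega) (by omega) hx
    omega

end IsArcOrder

namespace IsBypass

variable {o s y w v : ℝ × ℝ}

lemma isBranching_iff (h : IsBypass X o p s y w) (hgen : GeneralPosition X) (hX : 6 ≤ X.card) :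
    IsBranching (bypassTree X o p s y w) v ↔ v = p := by
  have hop := h.left_ne_center
  have hsp := h.right_ne_center
  have hos := h.left_ne_right
  have hyw := h.ne hgen
  have hyp := h.next_left.ne_left
  have hwp := h.next_right.ne_left
  constructor
  · rintro ⟨a, b, c, hab, hac, hbc, ha, hb, hc⟩
    by_contra hvp
    rw [bypassTree, mk_mem_parentTree] at ha hb hc
    grind
  · rintro rfl
    have hcard : 2 < (((X.erase v).erase y).erase w).card := by
      have h1 := (X.erase v).pred_card_le_card_erase (a := y)
      have h2 := ((X.erase v).erase y).pred_card_le_card_erase (a := w)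
      rw [Finset.card_erase_of_mem h.center_mem] at h1
      omega
    obtain ⟨a, ha, b, hb, c, hc, hab, hac, hbc⟩ := Finset.two_lt_card.1 hcard
    simp only [Finset.mem_erase] at ha hb hc
    refine ⟨a, b, c, hab, hac, hbc, ?_, ?_, ?_⟩ <;> rw [mem_bypassTree h hgen]
    · exact Or.inr (Or.inr ⟨a, by tauto⟩)
    · exact Or.inr (Or.inr ⟨b, by tauto⟩)
    · exact Or.inr (Or.inr ⟨c, by tauto⟩)

lemma isInternal_iff (h : IsBypass X o p s y w) (hgen : GeneralPosition X) (hX : 6 ≤ X.card) :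
    IsInternal (bypassTree X o p s y w) v ↔ v = o ∨ v = p ∨ v = s := by
  have hop := h.left_ne_center
  have hsp := h.right_ne_center
  have hos := h.left_ne_right
  have ho := h.left_mem
  have hs := h.right_mem
  have hyw := h.ne hgen
  have hyp := h.next_left.ne_left
  have hwp := h.next_right.ne_left
  have hyo := h.next_left.ne_right
  have hws := h.next_right.ne_right
  have hyX := h.next_left.mem
  have hwX := h.next_right.mem
  have hswap := h.not_swap
  constructor
  · intro hv
    rcases hv.eq_root_or_exists with hv | ⟨z, -, -, rfl⟩
    · exact Or.inr (Or.inl hv)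
    · grind
  · rintro (rfl | rfl | rfl)
    · by_cases hwo : w = v
      · exact ⟨y, s, fun hys => hswap hys hwo, (mem_bypassTree h hgen).2 (Or.inl rfl),
          (mem_bypassTree h hgen).2 (Or.inr (Or.inl (by rw [hwo, Sym2.eq_swap])))⟩
      · exact ⟨y, p, hyp, (mem_bypassTree h hgen).2 (Or.inl rfl), (mem_bypassTree h hgen).2
          (Or.inr (Or.inr ⟨v, ho, hop, hyo.symm, Ne.symm hwo, Sym2.eq_swap⟩))⟩
    · obtain ⟨a, b, -, hab, -, -, ha, hb, -⟩ := (h.isBranching_iff hgen hX).2 rfl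
      exact ⟨a, b, hab, ha, hb⟩
    · by_cases hys : y = v
      · exact ⟨w, o, fun hwo => hswap hys hwo, (mem_bypassTree h hgen).2 (Or.inr (Or.inl rfl)),
          (mem_bypassTree h hgen).2 (Or.inl (by rw [hys, Sym2.eq_swap]))⟩
      · exact ⟨w, p, hwp, (mem_bypassTree h hgen).2 (Or.inr (Or.inl rfl)),
          (mem_bypassTree h hgen).2
          (Or.inr (Or.inr ⟨v, hs, hsp, Ne.symm hys, hws.symm, Sym2.eq_swap⟩))⟩

end IsBypass

end Degrees

section Walk

lemma sum_range_mul_eq {β : Type*} [AddCommMonoid β] (f : ℕ → β) (m n : ℕ) :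
    ∑ t ∈ Finset.range (m * n), f t =
      ∑ k ∈ Finset.range m, ∑ i ∈ Finset.range n, f (k * n + i) := by
  induction m with
  | zero => simp
  | succ m ih => rw [Nat.succ_mul, Finset.sum_range_add, Finset.sum_range_succ, ih]

/-- The zigzag `0, 1, M - 1, 2, M - 2, …` through the residues modulo `M`. -/
def zigzag (M i : ℕ) : ℕ :=
  if i % 2 = 1 then (i + 1) / 2 else if i = 0 then 0 else M - i / 2

/-- The `i`-th vertex of the `k`-th cycle of Walecki's decomposition of the complete graph on
`{0, …, M}` into Hamiltonian cycles. -/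
def walecki (M k i : ℕ) : ℕ :=
  if i = 0 then M else if zigzag M (i - 1) + k < M then zigzag M (i - 1) + k
    else zigzag M (i - 1) + k - M

variable {M k k' i i' : ℕ}

lemma walecki_zero : walecki M k 0 = M := by simp [walecki]

lemma zigzag_lt (hi : i < M) : zigzag M i < M := by
  unfold zigzag
  split_ifs <;> omega

lemma zigzag_inj (hi : i < M) (hi' : i' < M) (h : zigzag M i = zigzag M i') : i = i' := by
  unfold zigzag at h
  split_ifs at h <;> omega

lemma zigzag_add_zigzag_succ (hi : i + 1 < M) :
    zigzag M i + zigzag M (i + 1) = (if i % 2 = 1 then 0 else 1) ∨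
      zigzag M i + zigzag M (i + 1) = (if i % 2 = 1 then 0 else 1) + M := by
  unfold zigzag
  split_ifs <;> first | contradiction | omega

lemma walecki_lt (hk : k < M) (hi : 0 < i) (hi' : i ≤ M) : walecki M k i < M := by
  have := zigzag_lt (show i - 1 < M by omega)
  unfold walecki
  split_ifs <;> omega

lemma walecki_inj (hk : k < M) (hi : i ≤ M) (hi' : i' ≤ M)
    (h : walecki M k i = walecki M k i') : i = i' := by
  rcases Nat.eq_zero_or_pos i with rfl | h0 <;> rcases Nat.eq_zero_or_pos i' with rfl | h0'
  · rfl
  · have := walecki_lt hk h0' hi'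
    rw [walecki_zero] at h
    omega
  · have := walecki_lt hk h0 hi
    rw [walecki_zero] at h
    omega
  · have h1 := zigzag_lt (show i - 1 < M by omega)
    have h2 := zigzag_lt (show i' - 1 < M by omega)
    have h3 : zigzag M (i - 1) = zigzag M (i' - 1) := by
      unfold walecki at h
      split_ifs at h <;> omega
    have := zigzag_inj (by omega) (by omega) h3
    omega

lemma walecki_add_walecki_succ (hk : k < M / 2) (hi : 0 < i) (hi' : i < M) :
    walecki M k i + walecki M k (i + 1) = 2 * k + i % 2 ∨
      walecki M k i + walecki M k (i + 1) = 2 * k + i % 2 + M := by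
  have h1 := zigzag_lt (show i - 1 < M by omega)
  have h2 := zigzag_lt (show i - 1 + 1 < M by omega)
  have h3 := zigzag_add_zigzag_succ (show i - 1 + 1 < M by omega)
  have h4 : i + 1 - 1 = i - 1 + 1 := by omega
  unfold walecki
  rw [h4]
  split_ifs at * <;> omega

lemma walecki_one (hk : k < M) : walecki M k 1 = k := by
  simp [walecki, zigzag, hk]

lemma walecki_self (hk : k < M / 2) : walecki M k M = (M + 1) / 2 + k := by
  unfold walecki zigzag
  split_ifs <;> omega

/-- The cycles of Walecki's decomposition are edge-disjoint. -/
lemma walecki_edge_inj (hk : k < M / 2) (hk' : k' < M / 2) (hi : i ≤ M) (hi' : i' ≤ M)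
    (h : s(walecki M k i, if i < M then walecki M k (i + 1) else M) =
      s(walecki M k' i', if i' < M then walecki M k' (i' + 1) else M)) : k = k' ∧ i = i' := by
  have key {k i : ℕ} (hk : k < M / 2) (hi : i ≤ M) :
      (i = 0 ∧ walecki M k i = M ∧ (if i < M then walecki M k (i + 1) else M) = k) ∨
      (i = M ∧ walecki M k i = (M + 1) / 2 + k ∧
        (if i < M then walecki M k (i + 1) else M) = M) ∨
      (0 < i ∧ i < M ∧ (if i < M then walecki M k (i + 1) else M) = walecki M k (i + 1) ∧
        walecki M k i < M ∧ walecki M k (i + 1) < M ∧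
        (walecki M k i + walecki M k (i + 1) = 2 * k + i % 2 ∨
          walecki M k i + walecki M k (i + 1) = 2 * k + i % 2 + M)) := by
    rcases Nat.eq_zero_or_pos i with rfl | h0
    · refine Or.inl ⟨rfl, walecki_zero, ?_⟩
      rw [if_pos (by omega), walecki_one (by omega)]
    · rcases hi.eq_or_lt with rfl | hlt
      · exact Or.inr (Or.inl ⟨rfl, walecki_self hk, if_neg (lt_irrefl _)⟩)
      · exact Or.inr (Or.inr ⟨h0, hlt, if_pos hlt, walecki_lt (by omega) h0 hi,
          walecki_lt (by omega) (by omega) (by omega), walecki_add_walecki_succ hk h0 hlt⟩)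
  rw [Sym2.eq_iff] at h
  rcases key hk hi with ⟨h1, h2, h3⟩ | ⟨h1, h2, h3⟩ | ⟨h0, h1, h2, h3, h4, h5⟩ <;>
    rcases key hk' hi' with ⟨h1', h2', h3'⟩ | ⟨h1', h2', h3'⟩ | ⟨h0', h1', h2', h3', h4', h5'⟩
  any_goals omega
  rw [h2, h2'] at h
  have hkk : k = k' := by omega
  subst hkk
  refine ⟨rfl, ?_⟩
  rcases h with ⟨h, -⟩ | ⟨ha, hb⟩
  · exact walecki_inj (by omega) hi hi' h
  · have := walecki_inj (by omega) hi (by omega) ha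
    have := walecki_inj (by omega) (by omega) hi' hb
    omega

/-- A closed walk of length `r * |X|` through `X` that visits every point `r` times and never
repeats an edge. -/
lemma exists_closed_trail {α : Type*} [DecidableEq α] (X : Finset α) (r : ℕ) (hr1 : 1 ≤ r)
    (hr2 : r ≤ (X.card - 1) / 2) :
    ∃ c : ℕ → α, (∀ t, c (t + r * X.card) = c t) ∧ (∀ t, c t ∈ X) ∧ (∀ t, c t ≠ c (t + 1)) ∧
      (∀ t t', s(c t, c (t + 1)) = s(c t', c (t' + 1)) → t ≡ t' [MOD r * X.card]) ∧
      ∀ v ∈ X, ∑ t ∈ Finset.range (r * X.card), (if c t = v then 1 else 0) = r := by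
  obtain ⟨M, hM⟩ : ∃ M, X.card = M + 1 := ⟨X.card - 1, by omega⟩
  have hrM : r ≤ M / 2 := by simpa [hM] using hr2
  have hk (t : ℕ) : t / (M + 1) % r < M / 2 := (Nat.mod_lt _ hr1).trans_le hrM
  have hi (t : ℕ) : t % (M + 1) ≤ M := Nat.lt_succ_iff.1 (Nat.mod_lt _ M.succ_pos)
  have hle {k i : ℕ} (hk : k < M / 2) (hi : i ≤ M) : walecki M k i < M + 1 := by
    rcases Nat.eq_zero_or_pos i with rfl | h0
    · rw [walecki_zero]; omega
    · exact (walecki_lt (by omega) h0 hi).trans M.lt_succ_self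
  let e : Fin (M + 1) ≃ X := (X.equivFinOfCardEq hM).symm
  let a (t : ℕ) : Fin (M + 1) := ⟨walecki M (t / (M + 1) % r) (t % (M + 1)), hle (hk t) (hi t)⟩
  have hsucc (t : ℕ) : (a (t + 1)).1 = if t % (M + 1) < M then
      walecki M (t / (M + 1) % r) (t % (M + 1) + 1) else M := by
    have ht : t + 1 = (M + 1) * (t / (M + 1)) + (t % (M + 1) + 1) := by
      rw [← add_assoc, Nat.div_add_mod]
    have h0 := hi t
    change walecki M ((t + 1) / (M + 1) % r) ((t + 1) % (M + 1)) = _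
    generalize t / (M + 1) = k at *
    generalize t % (M + 1) = i at *
    rw [ht, Nat.mul_add_mod, Nat.mul_add_div M.succ_pos]
    split_ifs with h1
    · rw [Nat.div_eq_of_lt (Nat.succ_lt_succ h1), add_zero, Nat.mod_eq_of_lt (Nat.succ_lt_succ h1)]
    · rw [show i + 1 = M + 1 by omega, Nat.mod_self, walecki_zero]
  have hedge (t t' : ℕ) (h : s(a t, a (t + 1)) = s(a t', a (t' + 1))) :
      t ≡ t' [MOD r * (M + 1)] := by
    have h' := congrArg (Sym2.map Fin.val) h
    simp only [Sym2.map_mk, hsucc] at h'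
    obtain ⟨h1, h2⟩ := walecki_edge_inj (hk t) (hk t') (hi t) (hi t') h'
    rw [Nat.ModEq, mul_comm r, Nat.mod_mul, Nat.mod_mul, h1, h2]
  rw [hM]
  refine ⟨fun t => e (a t), fun t => ?_, fun t => (e (a t)).2, fun t h => ?_, fun t t' h => ?_,
    fun v hv => ?_⟩
  · have : a (t + r * (M + 1)) = a t := by
      simp only [a, Nat.add_mul_mod_self_right, Nat.add_mul_div_right _ _ M.succ_pos,
        Nat.add_mod_right]
    simp only [this]
  · have := e.injective (Subtype.ext h)
    have h1 := congrArg Fin.val this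
    rw [hsucc] at h1
    have h0 := hi t
    have hkt := hk t
    split_ifs at h1 with h2
    · have := walecki_inj (by omega) h0 (by omega) h1
      omega
    · have := walecki_lt (M := M) (show t / (M + 1) % r < M by omega)
        (show 0 < t % (M + 1) by omega) h0
      exact this.ne h1
  · refine hedge t t' ?_
    have hinj : Function.Injective fun j => (e j).1 := Subtype.val_injective.comp e.injective
    exact Sym2.map.injective hinj h
  · rw [sum_range_mul_eq]
    have : ∀ k ∈ Finset.range r, ∑ i ∈ Finset.range (M + 1),
        (if (e (a (k * (M + 1) + i))).1 = v then 1 else 0) = 1 := by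
      intro k hkr
      rw [Finset.mem_range] at hkr
      let σ (i : Fin (M + 1)) : Fin (M + 1) :=
        ⟨walecki M k i, hle (by omega) (Nat.lt_succ_iff.1 i.2)⟩
      have hσ : Function.Injective σ := fun i i' h => Fin.ext <|
        walecki_inj (by omega) (Nat.lt_succ_iff.1 i.2) (Nat.lt_succ_iff.1 i'.2)
          (congrArg Fin.val h)
      have ha (i : Fin (M + 1)) : a (k * (M + 1) + i) = σ i := by
        apply Fin.ext
        change walecki M ((k * (M + 1) + i) / (M + 1) % r) ((k * (M + 1) + i) % (M + 1)) = _
        rw [mul_comm k, Nat.mul_add_mod, Nat.mul_add_div M.succ_pos, Nat.div_eq_of_lt i.2,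
          Nat.mod_eq_of_lt i.2, add_zero, Nat.mod_eq_of_lt hkr]
      rw [Finset.sum_range]
      simp only [ha]
      rw [Fintype.sum_equiv ((Equiv.ofBijective σ (Finite.injective_iff_bijective.1 hσ)).trans e)
        _ (fun u : X => if u = ⟨v, hv⟩ then 1 else 0) (fun i => by simp [Subtype.ext_iff])]
      simp
    rw [Finset.sum_congr rfl this]
    simp

end Walk

section Distinct

variable {X : Finset (ℝ × ℝ)} {p q p' q' o s y w o' s' y' w' : ℝ × ℝ} {x x' : ℕ → ℝ × ℝ}
  {rk rk' : ℝ × ℝ → ℕ} {J J' : ℕ}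

lemma IsBypass.eq_of_bypassTree_eq (h : IsBypass X o p s y w) (h' : IsBypass X o' p' s' y' w')
    (hgen : GeneralPosition X) (hX : 6 ≤ X.card)
    (hT : bypassTree X o p s y w = bypassTree X o' p' s' y' w') :
    p = p' ∧ (o = o' ∨ o = s') := by
  have h1 := (h.isBranching_iff (v := p) hgen hX).2 rfl
  rw [hT, h'.isBranching_iff hgen hX] at h1
  have h2 := (h.isInternal_iff (v := o) hgen hX).2 (Or.inl rfl)
  rw [hT, h'.isInternal_iff hgen hX] at h2
  have := h.left_ne_center
  grind

namespace IsArcOrder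

lemma eq_of_doubleStar_eq (h : IsArcOrder X p q x rk J) (h' : IsArcOrder X p' q' x' rk' J')
    {K K' : ℕ} (hK : 0 < K) (hK' : 0 < K') (hKX : K < X.card - 2) (hKX' : K' < X.card - 2)
    (hT : doubleStar X p q rk K = doubleStar X p' q' rk' K') : s(p, q) = s(p', q') := by
  have h1 := (h.isInternal_doubleStar_iff (v := p) hK hKX).2 (Or.inl rfl)
  have h2 := (h.isInternal_doubleStar_iff (v := q) hK hKX).2 (Or.inr rfl)
  rw [hT, h'.isInternal_doubleStar_iff hK' hKX'] at h1 h2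
  have := h.ne
  rw [Sym2.eq_iff]
  grind

lemma doubleStar_inj (h : IsArcOrder X p q x rk J) {K K' : ℕ} (hK : K < X.card - 2)
    (hK' : K' < X.card - 2) (hT : doubleStar X p q rk K = doubleStar X p q rk K') : K = K' := by
  rcases lt_trichotomy K K' with hlt | rfl | hlt
  · exact absurd (hT ▸ h.apply_mem_doubleStar hK hlt) (h.apply_notMem_doubleStar hK le_rfl)
  · rfl
  · exact absurd (hT ▸ h.apply_mem_doubleStar hK' hlt) (h.apply_notMem_doubleStar hK' le_rfl)

lemma eq_of_detourTree_eq (h : IsArcOrder X p q x rk J) (h' : IsArcOrder X p' q' x' rk' J')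
    (hT : detourTree X p q (x J) rk J = detourTree X p' q' (x' J') rk' J') :
    s(p, q) = s(p', q') := by
  have hX := h.six_le
  have hJ : J < X.card - 2 := by have := h.detour_eq; omega
  have hJ' : J' < X.card - 2 := by have := h'.detour_eq; omega
  have h1 := (h.isInternal_detourTree_iff (v := p)).2 (Or.inl rfl)
  have h2 := (h.isInternal_detourTree_iff (v := q)).2 (Or.inr (Or.inl rfl))
  have h3 := h.notMem_detourTree hJ
  rw [hT] at h1 h2 h3
  rw [h'.isInternal_detourTree_iff] at h1 h2
  have h4 := h'.left_apply_mem_detourTree hJ' le_rfl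
  have h5 := h'.right_apply_mem_detourTree hJ' le_rfl
  have := h.ne
  grind [Sym2.eq_swap]

lemma eq_of_detourTree_eq_bypassTree (h : IsArcOrder X p q x rk J)
    (h' : IsBypass X o' p' s' y' w') (hgen : GeneralPosition X)
    (hT : detourTree X p q (x J) rk J = bypassTree X o' p' s' y' w') :
    p = p' ∧ q = o' ∨ p = s' ∧ q = p' := by
  have hX := h.six_le
  have hJ : J < X.card - 2 := by have := h.detour_eq; omega
  have hpq := h.ne
  have hup := h.ne_left J hJ
  have huq := h.ne_right J hJ
  have hint {v : ℝ × ℝ} (hv : v = p ∨ v = q ∨ v = x J) : v = o' ∨ v = p' ∨ v = s' := by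
    rwa [← h'.isInternal_iff hgen hX, ← hT, h.isInternal_detourTree_iff]
  have hpint := hint (Or.inl rfl)
  have hqint := hint (Or.inr (Or.inl rfl))
  have huint := hint (Or.inr (Or.inr rfl))
  have hmem := h.notMem_detourTree hJ
  rw [hT, mem_bypassTree h' hgen] at hmem
  have hop := h'.left_ne_center
  have hsp := h'.right_ne_center
  have hos := h'.left_ne_right
  have hyo := h'.next_left.ne_right
  have hws := h'.next_right.ne_right
  rcases h.detour with ⟨h1, hor⟩ | ⟨h2, hor⟩
  · have hp := h.isBranching_detourTree_left h1
    rw [hT, h'.isBranching_iff hgen hX] at hp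
    subst hp
    by_cases hqo : q = o'
    · exact Or.inl ⟨rfl, hqo⟩
    have hq : q = s' := by grind
    have hu : x J = o' := by grind
    have hy : q = y' := by
      by_contra hqy
      exact hmem (Or.inr (Or.inr ⟨q, h.right_mem, hpq.symm, hqy, by rwa [hq, ne_comm], rfl⟩))
    have := h'.next_left.2.1
    rw [← hy, ← hu, orient_swap] at this
    linarith
  · have hq := h.isBranching_detourTree_right h2
    rw [hT, h'.isBranching_iff hgen hX] at hq
    subst hq
    by_cases hps : p = s'
    · exact Or.inr ⟨hps, rfl⟩
    have hp : p = o' := by grind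
    have hu : x J = s' := by grind
    have hy : p = w' := by
      by_contra hpw
      exact hmem (Or.inr (Or.inr
        ⟨p, h.left_mem, hpq, by rwa [hp, ne_comm], hpw, Sym2.eq_swap⟩))
    have := h'.next_right.2.1
    rw [← hy, ← hu, orient_rotate] at this
    linarith

end IsArcOrder

/-- If the star at `p` between the arcs `op` and `pq` cannot be bypassed, then one of `o` and `q`
has no point of `X` to its left, as seen from `p`. -/
lemma exists_forall_orient_nonpos (h : IsArcOrder X o p x rk J)
    (h' : IsArcOrder X p q x' rk' J') (hoq : o ≠ q)
    (hB : ¬ IsBypass X o p q (x (X.card - 3)) (x' 0)) :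
    ∃ u ∈ X, u ≠ p ∧ (u = o ∨ u = q) ∧ ∀ z ∈ X, orient p u z ≤ 0 := by
  by_contra! hne
  obtain ⟨z, hz, hz'⟩ := hne o h.left_mem h.ne (Or.inl rfl)
  obtain ⟨z', hw, hw'⟩ := hne q h'.right_mem h'.ne.symm (Or.inr rfl)
  exact hB ⟨h.right_mem, h.left_mem, h'.right_mem, h.ne, h'.ne.symm, hoq, h.last z hz hz',
    h'.first z' hw hw'⟩

lemma eq_of_forall_orient_nonpos (hgen : GeneralPosition X) (hp : p ∈ X) {u u' : ℝ × ℝ}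
    (hu : u ∈ X) (hup : u ≠ p) (h : ∀ z ∈ X, orient p u z ≤ 0) (hu' : u' ∈ X) (hup' : u' ≠ p)
    (h' : ∀ z ∈ X, orient p u' z ≤ 0) : u = u' := by
  by_contra hne
  have h1 := h u' hu'
  have h2 := h' u hu
  rw [orient_swap] at h2
  exact hgen.orient_ne_zero hp hu hu' hup.symm hup'.symm hne (by linarith)

end Distinct

section Block

open Classical in
/-- The `k`-th tree of the block of trees leading from the star at `p` to the star at `q`, when the
preceding block starts at `o`. -/
noncomputable def blockTree (X : Finset (ℝ × ℝ)) (x : ℝ × ℝ → ℝ × ℝ → ℕ → ℝ × ℝ)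
    (rk : ℝ × ℝ → ℝ × ℝ → ℝ × ℝ → ℕ) (J : ℝ × ℝ → ℝ × ℝ → ℕ) (o p q : ℝ × ℝ) (k : ℕ) :
    Finset (Sym2 (ℝ × ℝ)) :=
  if k = 0 then
    if IsBypass X o p q (x o p (X.card - 3)) (x p q 0) then
      bypassTree X o p q (x o p (X.card - 3)) (x p q 0)
    else starTree X p
  else if k ≤ J p q then doubleStar X p q (rk p q) k
  else if k = J p q + 1 then detourTree X p q (x p q (J p q)) (rk p q) (J p q)
  else doubleStar X p q (rk p q) (k - 1)

/-- The other endpoint of the `k`-th edge at `q` inserted between the star at `p` and the star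
at `q`. -/
def arcVertex (p : ℝ × ℝ) (x : ℕ → ℝ × ℝ) (J k : ℕ) : ℝ × ℝ :=
  if k ≤ J then x k else if k = J + 1 then p else x (k - 1)

open Classical in
/-- The edge inserted after the `k`-th tree of the block from `p` to `q`, when the preceding block
starts at `o` and the following block ends at `s`. -/
noncomputable def blockLabel (X : Finset (ℝ × ℝ)) (x : ℝ × ℝ → ℝ × ℝ → ℕ → ℝ × ℝ)
    (J : ℝ × ℝ → ℝ × ℝ → ℕ) (o p q s : ℝ × ℝ) (k : ℕ) : Sym2 (ℝ × ℝ) :=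
  if k = 0 ∧ IsBypass X o p q (x o p (X.card - 3)) (x p q 0) then
    s(p, arcVertex o (x o p) (J o p) (X.card - 2))
  else if k = X.card - 2 ∧ IsBypass X p q s (x p q (X.card - 3)) (x q s 0) then
    s(s, arcVertex q (x q s) (J q s) 0)
  else s(q, arcVertex p (x p q) (J p q) k)

variable {X : Finset (ℝ × ℝ)} {x : ℝ × ℝ → ℝ × ℝ → ℕ → ℝ × ℝ}
  {rk : ℝ × ℝ → ℝ × ℝ → ℝ × ℝ → ℕ} {J : ℝ × ℝ → ℝ × ℝ → ℕ} {o p q s : ℝ × ℝ} {k : ℕ}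

lemma blockTree_zero_of_isBypass (h : IsBypass X o p q (x o p (X.card - 3)) (x p q 0)) :
    blockTree X x rk J o p q 0 = bypassTree X o p q (x o p (X.card - 3)) (x p q 0) := by
  simp [blockTree, h]

lemma blockTree_zero_of_not_isBypass (h : ¬ IsBypass X o p q (x o p (X.card - 3)) (x p q 0)) :
    blockTree X x rk J o p q 0 = starTree X p := by
  simp [blockTree, h]

lemma blockTree_of_le (hk : 0 < k) (hk' : k ≤ J p q) :
    blockTree X x rk J o p q k = doubleStar X p q (rk p q) k := by
  simp [blockTree, hk.ne', hk']

lemma blockTree_add_one : blockTree X x rk J o p q (J p q + 1) =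
    detourTree X p q (x p q (J p q)) (rk p q) (J p q) := by
  simp [blockTree]

lemma blockTree_of_lt (hk : J p q < k) :
    blockTree X x rk J o p q (k + 1) = doubleStar X p q (rk p q) k := by
  rw [blockTree, if_neg (by omega), if_neg (by omega), if_neg (by omega), Nat.add_sub_cancel]

lemma isPlaneSpanningTree_blockTree (hgen : GeneralPosition X)
    (h : IsArcOrder X p q (x p q) (rk p q) (J p q)) :
    IsPlaneSpanningTree X (blockTree X x rk J o p q k) := by
  unfold blockTree
  split_ifs with h1 h2
  · exact h2.isPlaneSpanningTree hgen
  · exact isPlaneSpanningTree_starTree hgen h.left_mem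
  · exact h.isPlaneSpanningTree_doubleStar hgen _
  · exact h.isPlaneSpanningTree_detourTree hgen
  · exact h.isPlaneSpanningTree_doubleStar hgen _

lemma isFlip_doubleStar_blockTree (hgen : GeneralPosition X)
    (h : IsArcOrder X p q (x p q) (rk p q) (J p q)) (hk : k ≤ J p q) :
    IsFlip (doubleStar X p q (rk p q) k) s(q, arcVertex p (x p q) (J p q) k)
      (blockTree X x rk J o p q (k + 1)) := by
  have hX := h.six_le
  have hJ := h.detour_eq
  rw [arcVertex, if_pos hk]
  rcases hk.eq_or_lt with rfl | hk
  · rw [blockTree_add_one]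
    exact h.isFlip_doubleStar_detourTree hgen (by omega)
  · rw [blockTree_of_le (by omega) hk]
    exact h.isFlip_doubleStar hgen (by omega)

lemma isFlip_blockTree_succ (hgen : GeneralPosition X)
    (h : IsArcOrder X p q (x p q) (rk p q) (J p q)) (hk : 0 < k) (hkX : k < X.card - 1) :
    IsFlip (blockTree X x rk J o p q k) s(q, arcVertex p (x p q) (J p q) k)
      (if k = X.card - 2 then starTree X q else blockTree X x rk J o p q (k + 1)) := by
  have hX := h.six_le
  have hJ := h.detour_eq
  rcases lt_trichotomy k (J p q + 1) with hlt | heq | hlt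
  · rw [if_neg (by omega), blockTree_of_le hk (by omega)]
    exact isFlip_doubleStar_blockTree hgen h (by omega)
  · rw [if_neg (by omega), heq, blockTree_add_one, blockTree_of_lt (by omega), arcVertex,
      if_neg (by omega), if_pos rfl, Sym2.eq_swap]
    exact h.isFlip_detourTree_doubleStar hgen (by omega)
  · obtain ⟨k, rfl⟩ : ∃ l, k = l + 1 := ⟨k - 1, by omega⟩
    have key := h.isFlip_doubleStar hgen (show k < X.card - 2 by omega)
    rw [arcVertex, if_neg (by omega), if_neg (by omega), Nat.add_sub_cancel,
      blockTree_of_lt (by omega)]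
    split_ifs with hc
    · rwa [hc, h.doubleStar_card] at key
    · rwa [blockTree_of_lt (by omega)]

lemma isFlip_blockTree (hgen : GeneralPosition X)
    (ho : IsArcOrder X o p (x o p) (rk o p) (J o p))
    (h : IsArcOrder X p q (x p q) (rk p q) (J p q))
    (hk : k < X.card - 1) :
    IsFlip (blockTree X x rk J o p q k) (blockLabel X x J o p q s k)
      (if k = X.card - 2 then blockTree X x rk J p q s 0
        else blockTree X x rk J o p q (k + 1)) := by
  have hX := h.six_le
  have hJ := h.detour_eq
  have hJo := ho.detour_eq
  have hlast {o p : ℝ × ℝ} (ho : J o p = 1 ∨ J o p = 2) :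
      arcVertex o (x o p) (J o p) (X.card - 2) = x o p (X.card - 3) := by
    rw [arcVertex, if_neg (by omega), if_neg (by omega)]
    rfl
  have hfirst {p q : ℝ × ℝ} : arcVertex p (x p q) (J p q) 0 = x p q 0 := by simp [arcVertex]
  unfold blockLabel
  rcases Nat.eq_zero_or_pos k with rfl | hk0
  · have h0 : 0 ≠ X.card - 2 := by omega
    rw [if_neg h0]
    by_cases hB : IsBypass X o p q (x o p (X.card - 3)) (x p q 0)
    · rw [if_pos ⟨rfl, hB⟩, blockTree_zero_of_isBypass hB, hlast hJo, zero_add,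
        blockTree_of_le one_pos (by omega)]
      exact hB.isFlip_doubleStar h hgen
    · rw [if_neg (fun h => hB h.2), if_neg (fun h => h0 h.1), blockTree_zero_of_not_isBypass hB,
        ← IsArcOrder.doubleStar_zero (q := q) (rk := rk p q)]
      exact isFlip_doubleStar_blockTree hgen h (by omega)
  · rw [if_neg (fun hB => hk0.ne' hB.1)]
    have key := isFlip_blockTree_succ (o := o) hgen h hk0 hk
    by_cases hkX : k = X.card - 2
    · by_cases hB : IsBypass X p q s (x p q (X.card - 3)) (x q s 0)
      · rw [if_pos ⟨hkX, hB⟩, if_pos hkX, blockTree_zero_of_isBypass hB, hfirst, hkX,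
          show X.card - 2 = X.card - 3 + 1 by omega, blockTree_of_lt (by omega)]
        exact hB.isFlip_doubleStar_bypassTree h hgen
      · rw [if_neg (fun h => hB h.2), if_pos hkX, blockTree_zero_of_not_isBypass hB]
        rwa [if_pos hkX] at key
    · rw [if_neg (fun h => hkX h.1), if_neg hkX]
      rwa [if_neg hkX] at key

lemma arcVertex_inj (h : IsArcOrder X p q (x p q) (rk p q) (J p q)) {l : ℕ}
    (hk : k < X.card - 1) (hl : l < X.card - 1)
    (hkl : arcVertex p (x p q) (J p q) k = arcVertex p (x p q) (J p q) l) : k = l := by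
  have hX := h.six_le
  have hJ := h.detour_eq
  have hinj {k l : ℕ} (hk : k < X.card - 2) (hl : l < X.card - 2) := h.apply_inj hk hl
  have hne := h.ne_left
  unfold arcVertex at hkl
  split_ifs at hkl
  all_goals first
    | omega
    | exact absurd hkl (hne _ (by omega))
    | exact absurd hkl.symm (hne _ (by omega))
    | (have := hinj (by omega) (by omega) hkl; omega)

lemma sum_arcVertex (h : IsArcOrder X p q (x p q) (rk p q) (J p q)) {b : ℝ × ℝ} (hb : b ∈ X)
    (hbq : b ≠ q) : ∑ k ∈ Finset.range (X.card - 1),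
      (if arcVertex p (x p q) (J p q) k = b then 1 else 0) = 1 := by
  have hX := h.six_le
  have hJ := h.detour_eq
  obtain ⟨k, hk, rfl⟩ : ∃ k < X.card - 1, arcVertex p (x p q) (J p q) k = b := by
    by_cases hbp : b = p
    · exact ⟨J p q + 1, by omega, by simp [arcVertex, hbp]⟩
    · have h1 := h.rank_lt b hb hbp hbq
      have h2 := h.apply_rank b hb hbp hbq
      by_cases hJb : rk p q b ≤ J p q
      · exact ⟨rk p q b, by omega, by rw [arcVertex, if_pos hJb, h2]⟩
      · exact ⟨rk p q b + 1, by omega, by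
          rw [arcVertex, if_neg (by omega), if_neg (by omega), Nat.add_sub_cancel, h2]⟩
  rw [Finset.sum_eq_single_of_mem k (Finset.mem_range.2 hk)]
  · simp
  · intro l hl hlk
    rw [if_neg fun hkl => hlk (arcVertex_inj h (Finset.mem_range.1 hl) hk hkl)]

lemma sum_arcEdge (h : IsArcOrder X p q (x p q) (rk p q) (J p q)) {a b : ℝ × ℝ} (ha : a ∈ X)
    (hb : b ∈ X) (hab : a ≠ b) : ∑ k ∈ Finset.range (X.card - 1),
      (if s(q, arcVertex p (x p q) (J p q) k) = s(a, b) then 1 else 0) =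
        (if q = a then 1 else 0) + if q = b then 1 else 0 := by
  by_cases hqa : q = a
  · subst hqa
    have := sum_arcVertex h hb hab.symm
    simpa [hab] using this
  by_cases hqb : q = b
  · subst hqb
    rw [Sym2.eq_swap (a := a)]
    simpa [hqa] using sum_arcVertex h ha hab
  · simp [hqa, hqb]

end Block

section Cycle

lemma not_forall_eq_iff {α : Type*} {Q : α → Prop} {a b d : α} (hbd : b ≠ d) (hb : Q b)
    (hd : Q d) : ¬ ∀ v, v = a ↔ Q v :=
  fun h => hbd (((h b).2 hb).trans ((h d).2 hd).symm)

lemma not_forall_eq_or_eq_iff {α : Type*} {Q : α → Prop} {a a' b d e : α} (hbd : b ≠ d)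
    (hbe : b ≠ e) (hde : d ≠ e) (hb : Q b) (hd : Q d) (he : Q e) :
    ¬ ∀ v, v = a ∨ v = a' ↔ Q v := by
  intro h
  have h1 := (h b).2 hb
  have h2 := (h d).2 hd
  have h3 := (h e).2 he
  grind

/-- The four kinds of trees in a block. -/
lemma blockTree_cases {X : Finset (ℝ × ℝ)} {x : ℝ × ℝ → ℝ × ℝ → ℕ → ℝ × ℝ}
    {rk : ℝ × ℝ → ℝ × ℝ → ℝ × ℝ → ℕ} {J : ℝ × ℝ → ℝ × ℝ → ℕ} (o : ℝ × ℝ) {p q : ℝ × ℝ} {k : ℕ}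
    (h : IsArcOrder X p q (x p q) (rk p q) (J p q)) (hk : k < X.card - 1) :
    (k = 0 ∧ ¬ IsBypass X o p q (x o p (X.card - 3)) (x p q 0) ∧
      blockTree X x rk J o p q k = starTree X p) ∨
    (k = 0 ∧ IsBypass X o p q (x o p (X.card - 3)) (x p q 0) ∧ blockTree X x rk J o p q k =
      bypassTree X o p q (x o p (X.card - 3)) (x p q 0)) ∨
    (k = J p q + 1 ∧ blockTree X x rk J o p q k =
      detourTree X p q (x p q (J p q)) (rk p q) (J p q)) ∨
    ∃ K, 0 < K ∧ K < X.card - 2 ∧ k = (if K ≤ J p q then K else K + 1) ∧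
      blockTree X x rk J o p q k = doubleStar X p q (rk p q) K := by
  have hX := h.six_le
  have hJ := h.detour_eq
  rcases Nat.eq_zero_or_pos k with rfl | hk0
  · by_cases hB : IsBypass X o p q (x o p (X.card - 3)) (x p q 0)
    · exact Or.inr (Or.inl ⟨rfl, hB, blockTree_zero_of_isBypass hB⟩)
    · exact Or.inl ⟨rfl, hB, blockTree_zero_of_not_isBypass hB⟩
  refine Or.inr (Or.inr ?_)
  rcases lt_trichotomy k (J p q + 1) with hlt | rfl | hlt
  · exact Or.inr ⟨k, hk0, by omega, by rw [if_pos (by omega)],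
      blockTree_of_le hk0 (by omega)⟩
  · exact Or.inl ⟨rfl, blockTree_add_one⟩
  · obtain ⟨K, rfl⟩ : ∃ l, k = l + 1 := ⟨k - 1, by omega⟩
    exact Or.inr ⟨K, by omega, by omega, by rw [if_neg (by omega)], blockTree_of_lt (by omega)⟩

/-- A closed trail `c` of length `N` through `X`, together with orders for all arcs. -/
structure IsTrailSystem (X : Finset (ℝ × ℝ)) (x : ℝ × ℝ → ℝ × ℝ → ℕ → ℝ × ℝ)
    (rk : ℝ × ℝ → ℝ × ℝ → ℝ × ℝ → ℕ) (J : ℝ × ℝ → ℝ × ℝ → ℕ) (c : ℕ → ℝ × ℝ) (N : ℕ) : Prop where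
  general : GeneralPosition X
  isArcOrder : ∀ p ∈ X, ∀ q ∈ X, p ≠ q → IsArcOrder X p q (x p q) (rk p q) (J p q)
  two_le : 2 ≤ N
  periodic : ∀ t, c (t + N) = c t
  mem : ∀ t, c t ∈ X
  ne_succ : ∀ t, c t ≠ c (t + 1)
  modEq : ∀ t t', s(c t, c (t + 1)) = s(c t', c (t' + 1)) → t ≡ t' [MOD N]

namespace IsTrailSystem

variable {X : Finset (ℝ × ℝ)} {x : ℝ × ℝ → ℝ × ℝ → ℕ → ℝ × ℝ}
    {rk : ℝ × ℝ → ℝ × ℝ → ℝ × ℝ → ℕ} {J : ℝ × ℝ → ℝ × ℝ → ℕ} {c : ℕ → ℝ × ℝ} {N : ℕ}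
    {t t' k k' : ℕ}

lemma arc (h : IsTrailSystem X x rk J c N) (t : ℕ) :
    IsArcOrder X (c t) (c (t + 1)) (x (c t) (c (t + 1))) (rk (c t) (c (t + 1)))
      (J (c t) (c (t + 1))) :=
  h.isArcOrder _ (h.mem t) _ (h.mem _) (h.ne_succ t)

lemma apply_eq_of_modEq (h : IsTrailSystem X x rk J c N) (ht : t ≡ t' [MOD N]) : c t = c t' := by
  have hper : Function.Periodic c N := h.periodic
  rw [← hper.map_mod_nat t, ← hper.map_mod_nat t', ht]

lemma ne_add_two (h : IsTrailSystem X x rk J c N) (t : ℕ) : c t ≠ c (t + 2) := by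
  intro hc
  have h1 := h.modEq t (t + 1) (by rw [hc, Sym2.eq_swap])
  have h2 : 0 ≡ 1 [MOD N] := Nat.ModEq.add_left_cancel' t h1
  have := h.two_le
  rw [Nat.ModEq, Nat.mod_eq_of_lt (by omega), Nat.mod_eq_of_lt (by omega)] at h2
  omega

/-- Two consecutive pairs of the trail with the same centre and a common edge coincide. -/
lemma modEq_of_center_eq (h : IsTrailSystem X x rk J c N) (hp : c (t + 1) = c (t' + 1))
    {u : ℝ × ℝ} (hu : u = c t ∨ u = c (t + 2)) (hu' : u = c t' ∨ u = c (t' + 2)) :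
    t ≡ t' [MOD N] := by
  rcases hu with rfl | rfl <;> rcases hu' with hu | hu
  · exact h.modEq t t' (by rw [hu, hp])
  · have := h.modEq t (t' + 1) (by rw [hu, hp, Sym2.eq_swap])
    exact absurd ((h.apply_eq_of_modEq this).trans hp.symm) (h.ne_succ t)
  · have := h.modEq (t + 1) t' (by rw [show t + 1 + 1 = t + 2 from rfl, hu, hp, Sym2.eq_swap])
    exact absurd (hp.symm.trans (h.apply_eq_of_modEq this)).symm (h.ne_succ t')
  · exact Nat.ModEq.add_right_cancel' 1 (h.modEq (t + 1) (t' + 1)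
      (by rw [show t + 1 + 1 = t + 2 from rfl, hu, hp]))

/-- The `k`-th tree of the `t`-th block of the cycle. -/
noncomputable def tree (_ : IsTrailSystem X x rk J c N) (t k : ℕ) : Finset (Sym2 (ℝ × ℝ)) :=
  blockTree X x rk J (c t) (c (t + 1)) (c (t + 2)) k

/-- The edge inserted after the `k`-th tree of the `t`-th block of the cycle. -/
noncomputable def label (_ : IsTrailSystem X x rk J c N) (t k : ℕ) : Sym2 (ℝ × ℝ) :=
  blockLabel X x J (c t) (c (t + 1)) (c (t + 2)) (c (t + 3)) k

lemma modEq_of_not_isBypass (h : IsTrailSystem X x rk J c N)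
    (hB : ¬ IsBypass X (c t) (c (t + 1)) (c (t + 2))
      (x (c t) (c (t + 1)) (X.card - 3)) (x (c (t + 1)) (c (t + 2)) 0))
    (hB' : ¬ IsBypass X (c t') (c (t' + 1)) (c (t' + 2))
      (x (c t') (c (t' + 1)) (X.card - 3)) (x (c (t' + 1)) (c (t' + 2)) 0))
    (hp : c (t + 1) = c (t' + 1)) : t ≡ t' [MOD N] := by
  obtain ⟨u, hu, hup, hut, huz⟩ :=
    exists_forall_orient_nonpos (h.arc t) (h.arc (t + 1)) (h.ne_add_two t) hB
  obtain ⟨u', hu', hup', hut', huz'⟩ :=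
    exists_forall_orient_nonpos (h.arc t') (h.arc (t' + 1)) (h.ne_add_two t') hB'
  rw [← hp] at hup' huz'
  obtain rfl := eq_of_forall_orient_nonpos h.general (h.mem _) hu hup huz hu' hup' huz'
  exact h.modEq_of_center_eq hp hut hut'

/-- If a detour tree of the cycle agreed with a bypass tree, then the trail would repeat a
point. -/
lemma detourTree_ne_bypassTree (h : IsTrailSystem X x rk J c N) {y w : ℝ × ℝ}
    (hB : IsBypass X (c t') (c (t' + 1)) (c (t' + 2)) y w) :
    detourTree X (c (t + 1)) (c (t + 2)) (x (c (t + 1)) (c (t + 2)) (J (c (t + 1)) (c (t + 2))))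
      (rk (c (t + 1)) (c (t + 2))) (J (c (t + 1)) (c (t + 2))) ≠
      bypassTree X (c t') (c (t' + 1)) (c (t' + 2)) y w := by
  intro hT
  rcases (h.arc (t + 1)).eq_of_detourTree_eq_bypassTree hB h.general hT with ⟨hp, hq⟩ | ⟨hp, hq⟩
  · have := h.modEq (t + 1) t' (by rw [show t + 1 + 1 = t + 2 from rfl, hp, hq, Sym2.eq_swap])
    exact h.ne_succ t' ((h.apply_eq_of_modEq this).symm.trans hp)
  · have := h.modEq (t + 1) (t' + 1) (by
      rw [show t + 1 + 1 = t + 2 from rfl, show t' + 1 + 1 = t' + 2 from rfl, hp, hq, Sym2.eq_swap])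
    exact h.ne_succ (t' + 1) ((h.apply_eq_of_modEq this).symm.trans hp)

lemma tree_inj (h : IsTrailSystem X x rk J c N) (hk : k < X.card - 1) (hk' : k' < X.card - 1)
    (hT : h.tree t k = h.tree t' k') : t ≡ t' [MOD N] ∧ k = k' := by
  have hX := (h.arc t).six_le
  unfold tree at hT
  have hstar {t : ℕ} (v : ℝ × ℝ) : IsInternal (starTree X (c (t + 1))) v ↔ v = c (t + 1) :=
    isInternal_starTree_iff hX (h.mem _)
  have hdetour {t : ℕ} (v : ℝ × ℝ) := (h.arc (t + 1)).isInternal_detourTree_iff (v := v)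
  have hdouble {t K : ℕ} (hK : 0 < K) (hKX : K < X.card - 2) (v : ℝ × ℝ) :=
    (h.arc (t + 1)).isInternal_doubleStar_iff hK hKX (v := v)
  have hbypass {t : ℕ} {y w : ℝ × ℝ} (hB : IsBypass X (c t) (c (t + 1)) (c (t + 2)) y w)
    (v : ℝ × ℝ) := hB.isInternal_iff h.general hX (v := v)
  have hne1 (t : ℕ) := h.ne_succ t
  have hne2 (t : ℕ) := h.ne_add_two t
  have hJ {t : ℕ} : J (c (t + 1)) (c (t + 2)) < X.card - 2 := by
    have := (h.arc (t + 1)).detour_eq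
    change J (c (t + 1)) (c (t + 2)) = 1 ∨ J (c (t + 1)) (c (t + 2)) = 2 at this
    omega
  have hne3 (t : ℕ) := (h.arc (t + 1)).ne_left _ (hJ (t := t))
  have hne4 (t : ℕ) := (h.arc (t + 1)).ne_right _ (hJ (t := t))
  have hmod {t t' : ℕ} (he : s(c (t + 1), c (t + 2)) = s(c (t' + 1), c (t' + 2))) :
      t ≡ t' [MOD N] := Nat.ModEq.add_right_cancel' 1 (h.modEq (t + 1) (t' + 1) he)
  have hcongr {t t' : ℕ} (ht : t ≡ t' [MOD N]) :
      c (t + 1) = c (t' + 1) ∧ c (t + 2) = c (t' + 2) :=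
    ⟨h.apply_eq_of_modEq (ht.add_right 1), h.apply_eq_of_modEq (ht.add_right 2)⟩
  have hset {T T' : Finset (Sym2 (ℝ × ℝ))} {P Q : ℝ × ℝ → Prop} (hTT : T = T')
    (hP : ∀ v, IsInternal T v ↔ P v) (hQ : ∀ v, IsInternal T' v ↔ Q v) (v : ℝ × ℝ) : P v ↔ Q v := by
    rw [← hP, ← hQ, hTT]
  rcases blockTree_cases (c t) (h.arc (t + 1)) hk with ⟨hk0, hB, he⟩ | ⟨hk0, hB, he⟩ | ⟨hk0, he⟩ |
    ⟨K, hK, hKX, hk0, he⟩ <;>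
  rcases blockTree_cases (c t') (h.arc (t' + 1)) hk' with ⟨hk0', hB', he'⟩ | ⟨hk0', hB', he'⟩ |
    ⟨hk0', he'⟩ | ⟨K', hK', hKX', hk0', he'⟩ <;>
  replace hT := he.symm.trans (hT.trans he') <;> clear he he'
  · have hp := (hset hT hstar hstar (c (t + 1))).1 rfl
    exact ⟨h.modEq_of_not_isBypass hB hB' hp, hk0.trans hk0'.symm⟩
  · exact absurd (hset hT hstar (hbypass hB'))
      (not_forall_eq_iff (hne1 t') (by simp) (by simp))
  · exact absurd (hset hT hstar hdetour)
      (not_forall_eq_iff (hne1 (t' + 1)) (by simp) (by simp))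
  · exact absurd (hset hT hstar (hdouble hK' hKX'))
      (not_forall_eq_iff (hne1 (t' + 1)) (by simp) (by simp))
  · exact absurd (hset hT.symm hstar (hbypass hB))
      (not_forall_eq_iff (hne1 t) (by simp) (by simp))
  · obtain ⟨hp, ho⟩ := hB.eq_of_bypassTree_eq hB' h.general hX hT
    exact ⟨h.modEq_of_center_eq hp (Or.inl rfl) ho, hk0.trans hk0'.symm⟩
  · exact absurd hT.symm (h.detourTree_ne_bypassTree hB)
  · exact absurd (hset hT.symm (hdouble hK' hKX') (hbypass hB))
      (not_forall_eq_or_eq_iff (hne1 t) (hne2 t) (hne1 (t + 1)) (by simp) (by simp) (by simp))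
  · exact absurd (hset hT.symm hstar hdetour)
      (not_forall_eq_iff (hne1 (t + 1)) (by simp) (by simp))
  · exact absurd hT (h.detourTree_ne_bypassTree hB')
  · have ht := hmod ((h.arc (t + 1)).eq_of_detourTree_eq (h.arc (t' + 1)) hT)
    obtain ⟨hp, hq⟩ := hcongr ht
    exact ⟨ht, by rw [hk0, hk0', hp, hq]⟩
  · exact absurd (hset hT.symm (hdouble hK' hKX') hdetour)
      (not_forall_eq_or_eq_iff (hne1 (t + 1)) (hne3 t).symm (hne4 t).symm (by simp) (by simp)
        (by simp))
  · exact absurd (hset hT.symm hstar (hdouble hK hKX))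
      (not_forall_eq_iff (hne1 (t + 1)) (by simp) (by simp))
  · exact absurd (hset hT (hdouble hK hKX) (hbypass hB'))
      (not_forall_eq_or_eq_iff (hne1 t') (hne2 t') (hne1 (t' + 1)) (by simp) (by simp) (by simp))
  · exact absurd (hset hT (hdouble hK hKX) hdetour)
      (not_forall_eq_or_eq_iff (hne1 (t' + 1)) (hne3 t').symm (hne4 t').symm (by simp) (by simp)
        (by simp))
  · have ht := hmod ((h.arc (t + 1)).eq_of_doubleStar_eq (h.arc (t' + 1)) hK hK' hKX hKX' hT)
    obtain ⟨hp, hq⟩ := hcongr ht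
    rw [← hp, ← hq] at hT
    have hKK := (h.arc (t + 1)).doubleStar_inj hKX hKX' hT
    exact ⟨ht, by rw [hk0, hk0', hp, hq, hKK]⟩

end IsTrailSystem
end Cycle

section Count

lemma sum_range_succ_of_periodic {f : ℕ → ℕ} {N : ℕ} (hf : Function.Periodic f N) :
    ∑ t ∈ Finset.range N, f (t + 1) = ∑ t ∈ Finset.range N, f t := by
  have h := Finset.sum_range_succ f N
  rw [Finset.sum_range_succ', hf.eq] at h
  exact Nat.add_right_cancel h

namespace IsTrailSystem

variable {X : Finset (ℝ × ℝ)} {x : ℝ × ℝ → ℝ × ℝ → ℕ → ℝ × ℝ}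
    {rk : ℝ × ℝ → ℝ × ℝ → ℝ × ℝ → ℕ} {J : ℝ × ℝ → ℝ × ℝ → ℕ} {c : ℕ → ℝ × ℝ} {N : ℕ}
    {t k : ℕ}

lemma isPlaneSpanningTree_tree (h : IsTrailSystem X x rk J c N) :
    IsPlaneSpanningTree X (h.tree t k) :=
  isPlaneSpanningTree_blockTree h.general (h.arc (t + 1))

lemma isFlip_tree (h : IsTrailSystem X x rk J c N) (hk : k < X.card - 1) :
    IsFlip (h.tree t k) (h.label t k)
      (if k = X.card - 2 then h.tree (t + 1) 0 else h.tree t (k + 1)) :=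
  isFlip_blockTree h.general (h.arc t) (h.arc (t + 1)) hk

lemma periodic_add (h : IsTrailSystem X x rk J c N) (t i : ℕ) : c (t + N + i) = c (t + i) := by
  rw [add_right_comm, h.periodic]

lemma tree_add (h : IsTrailSystem X x rk J c N) : h.tree (t + N) k = h.tree t k := by
  simp only [tree, h.periodic_add, h.periodic]

lemma label_add (h : IsTrailSystem X x rk J c N) : h.label (t + N) k = h.label t k := by
  simp only [label, h.periodic_add, h.periodic]

/-- The `k`-th edge at the endpoint of the `t`-th arc inserted along this arc. -/
noncomputable def arcEdge (_ : IsTrailSystem X x rk J c N) (t k : ℕ) : Sym2 (ℝ × ℝ) :=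
  s(c (t + 1), arcVertex (c t) (x (c t) (c (t + 1))) (J (c t) (c (t + 1))) k)

lemma arcEdge_add (h : IsTrailSystem X x rk J c N) : h.arcEdge (t + N) k = h.arcEdge t k := by
  simp only [arcEdge, h.periodic_add, h.periodic]

lemma label_of_pos_of_lt (h : IsTrailSystem X x rk J c N) (hk : 0 < k) (hkX : k < X.card - 2) :
    h.label t k = h.arcEdge (t + 1) k := by
  rw [label, blockLabel, if_neg (fun hc => hk.ne' hc.1), if_neg (fun hc => hkX.ne hc.1)]
  rfl

/-- A bypass merely exchanges the two labels next to it. -/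
lemma label_last_add_label_zero (h : IsTrailSystem X x rk J c N) (φ : Sym2 (ℝ × ℝ) → ℕ) :
    φ (h.label t (X.card - 2)) + φ (h.label (t + 1) 0) =
      φ (h.arcEdge (t + 1) (X.card - 2)) + φ (h.arcEdge (t + 2) 0) := by
  have hX := (h.arc t).six_le
  have h0 : X.card - 2 ≠ 0 := by omega
  unfold label blockLabel
  rw [if_neg (fun hc => h0 hc.1)]
  by_cases hB : IsBypass X (c (t + 1)) (c (t + 2)) (c (t + 3))
    (x (c (t + 1)) (c (t + 2)) (X.card - 3)) (x (c (t + 2)) (c (t + 3)) 0)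
  · rw [if_pos ⟨rfl, hB⟩, if_pos ⟨rfl, hB⟩, add_comm]
    rfl
  · rw [if_neg (fun hc => hB hc.2), if_neg (fun hc => hB hc.2), if_neg (fun hc => h0 hc.1.symm)]
    rfl

lemma sum_label (h : IsTrailSystem X x rk J c N) (φ : Sym2 (ℝ × ℝ) → ℕ) :
    ∑ t ∈ Finset.range N, ∑ k ∈ Finset.range (X.card - 1), φ (h.label t k) =
      ∑ t ∈ Finset.range N, ∑ k ∈ Finset.range (X.card - 1), φ (h.arcEdge t k) := by
  have hX := (h.arc 0).six_le
  obtain ⟨m, hm⟩ : ∃ m, X.card - 2 = m + 1 := ⟨X.card - 3, by omega⟩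
  have hsum {G : ℕ → ℕ → ℕ} :
      ∑ t ∈ Finset.range N, ∑ k ∈ Finset.range (X.card - 1), G t k =
      ∑ t ∈ Finset.range N, ∑ k ∈ Finset.range m, G t (k + 1) +
        (∑ t ∈ Finset.range N, G t 0 + ∑ t ∈ Finset.range N, G t (X.card - 2)) := by
    rw [show X.card - 1 = m + 1 + 1 by omega, hm, ← Finset.sum_add_distrib,
      ← Finset.sum_add_distrib]
    refine Finset.sum_congr rfl fun t _ => ?_
    rw [Finset.sum_range_succ, Finset.sum_range_succ', add_assoc]
  have hlabel (k : ℕ) := sum_range_succ_of_periodic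
    (show Function.Periodic (fun t => φ (h.label t k)) N from fun t => by simp only [h.label_add])
  have hedge (k : ℕ) := sum_range_succ_of_periodic
    (show Function.Periodic (fun t => φ (h.arcEdge t k)) N from
      fun t => by simp only [h.arcEdge_add])
  have hedge' (k : ℕ) := sum_range_succ_of_periodic
    (show Function.Periodic (fun t => φ (h.arcEdge (t + 1) k)) N from
      fun t => by simp only [add_right_comm t N 1, h.arcEdge_add])
  have hedge'' := sum_range_succ_of_periodic
    (show Function.Periodic (fun t => ∑ k ∈ Finset.range m, φ (h.arcEdge t (k + 1))) N from
      fun t => by simp only [h.arcEdge_add])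
  have hpair := Finset.sum_congr (rfl : Finset.range N = Finset.range N)
    fun t _ => h.label_last_add_label_zero (t := t) φ
  rw [Finset.sum_add_distrib, Finset.sum_add_distrib, hlabel 0, hedge (X.card - 2), hedge' 0,
    hedge 0] at hpair
  rw [hsum, hsum, add_comm (∑ t ∈ Finset.range N, φ (h.label t 0)), hpair, ← hedge'',
    add_comm (∑ t ∈ Finset.range N, φ (h.arcEdge t (X.card - 2)))]
  congr 1
  refine Finset.sum_congr rfl fun t _ => Finset.sum_congr rfl fun k hk => ?_
  have := Finset.mem_range.1 hk
  rw [h.label_of_pos_of_lt k.succ_pos (by omega)]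

lemma sum_label_eq (h : IsTrailSystem X x rk J c N) {r : ℕ}
    (hr : ∀ v ∈ X, ∑ t ∈ Finset.range N, (if c t = v then 1 else 0) = r) {a b : ℝ × ℝ}
    (ha : a ∈ X) (hb : b ∈ X) (hab : a ≠ b) :
    ∑ t ∈ Finset.range N, ∑ k ∈ Finset.range (X.card - 1),
      (if h.label t k = s(a, b) then 1 else 0) = 2 * r := by
  have hshift (v : ℝ × ℝ) := sum_range_succ_of_periodic
    (show Function.Periodic (fun t => if c t = v then 1 else 0) N from
      fun t => by simp only [h.periodic])
  rw [h.sum_label (fun e => if e = s(a, b) then 1 else 0)]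
  refine (Finset.sum_congr rfl fun t _ => sum_arcEdge (h.arc t) ha hb hab).trans ?_
  rw [Finset.sum_add_distrib, hshift, hshift, hr a ha, hr b hb, two_mul]

lemma isRainbowCycleS (h : IsTrailSystem X x rk J c N) {r : ℕ}
    (hr : ∀ v ∈ X, ∑ t ∈ Finset.range N, (if c t = v then 1 else 0) = r) :
    IsRainbowCycleS X (2 * r) (N * (X.card - 1))
      fun i => h.tree (i / (X.card - 1)) (i % (X.card - 1)) := by
  have hX := (h.arc 0).six_le
  have hN := h.two_le
  have hM : 0 < X.card - 1 := by omega
  have hmod (i : ℕ) : i % (X.card - 1) < X.card - 1 := Nat.mod_lt _ hM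
  have hflip (i : ℕ) : IsFlip (h.tree (i / (X.card - 1)) (i % (X.card - 1)))
      (h.label (i / (X.card - 1)) (i % (X.card - 1)))
      (h.tree ((i + 1) / (X.card - 1)) ((i + 1) % (X.card - 1))) := by
    have key := h.isFlip_tree (t := i / (X.card - 1)) (hmod i)
    split_ifs at key with hi
    · have hdvd : X.card - 1 ∣ i + 1 := ⟨i / (X.card - 1) + 1, by
        have := Nat.div_add_mod i (X.card - 1)
        rw [mul_add, mul_one]
        omega⟩
      rwa [Nat.succ_div_of_dvd hdvd, Nat.mod_eq_zero_of_dvd hdvd]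
    · have hdvd : ¬ X.card - 1 ∣ i + 1 := by
        intro hd
        have h1 := Nat.mod_eq_zero_of_dvd hd
        rw [Nat.add_mod, Nat.mod_eq_of_lt (show 1 < X.card - 1 by omega)] at h1
        have h2 := hmod i
        rw [Nat.mod_eq_of_lt (by omega)] at h1
        omega
      rwa [Nat.succ_div_of_not_dvd hdvd, Nat.add_mod,
        Nat.mod_eq_of_lt (show 1 < X.card - 1 by omega),
        Nat.mod_eq_of_lt (show i % (X.card - 1) + 1 < X.card - 1 by have := hmod i; omega)]
  refine ⟨Nat.mul_pos (by omega) hM, fun i => ?_, fun i hi j hj hij => ?_,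
    fun i => h.isPlaneSpanningTree_tree, fun i => ?_, fun p hp q hq hpq => ?_⟩
  · simp only [Nat.add_mul_div_right _ _ hM, Nat.add_mul_mod_self_right, h.tree_add]
  · obtain ⟨h1, h2⟩ := h.tree_inj (hmod i) (hmod j) hij
    have hdiv {i : ℕ} (hi : i < N * (X.card - 1)) : i / (X.card - 1) < N :=
      Nat.div_lt_of_lt_mul (by rwa [mul_comm])
    rw [← Nat.div_add_mod i (X.card - 1), ← Nat.div_add_mod j (X.card - 1), h2,
      h1.eq_of_lt_of_lt (hdiv hi) (hdiv hj)]
  · obtain ⟨hf, e, he, hT⟩ := hflip i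
    exact ⟨e, _, he, hf, hT⟩
  · have henter (i : ℕ) :
        (s(p, q) ∈ h.tree ((i + 1) / (X.card - 1)) ((i + 1) % (X.card - 1)) ∧
          s(p, q) ∉ h.tree (i / (X.card - 1)) (i % (X.card - 1))) ↔
        h.label (i / (X.card - 1)) (i % (X.card - 1)) = s(p, q) := by
      obtain ⟨hf, e, -, hT⟩ := hflip i
      rw [hT, Finset.mem_insert, Finset.mem_erase]
      constructor
      · rintro ⟨hpq | hpq, hpq'⟩
        · exact hpq.symm
        · exact absurd hpq.2 hpq'
      · rintro hpq
        exact ⟨Or.inl hpq.symm, hpq ▸ hf⟩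
    rw [Finset.filter_congr fun i _ => henter i, Finset.card_filter, sum_range_mul_eq,
      ← h.sum_label_eq hr hp hq hpq]
    refine Finset.sum_congr rfl fun t _ => Finset.sum_congr rfl fun k hk => ?_
    rw [add_comm (t * _), Nat.add_mul_div_right _ _ hM, Nat.add_mul_mod_self_right,
      Nat.div_eq_of_lt (Finset.mem_range.1 hk), Nat.mod_eq_of_lt (Finset.mem_range.1 hk), zero_add]

end IsTrailSystem
end Count
/-- Let `X` be a set of `n ≥ 6` points in general position. For every `r` with
`1 ≤ r ≤ ⌊(n-1)/2⌋`, the flip graph of plane spanning trees on `X` contains a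
`2r`-rainbow cycle; it has length `2r·C(n,2)`. -/
theorem plane_trees_even_rainbow_cycle (X : Finset (ℝ × ℝ)) (hX : 6 ≤ X.card)
    (hgen : GeneralPosition X) (r : ℕ) (hr1 : 1 ≤ r) (hr2 : r ≤ (X.card - 1) / 2) :
    ∃ V : ℕ → Finset (Sym2 (ℝ × ℝ)),
      IsRainbowCycleS X (2 * r) (2 * r * X.card.choose 2) V := by
  have hex (p q : ℝ × ℝ) : ∃ x rk J, p ∈ X → q ∈ X → p ≠ q → IsArcOrder X p q x rk J := by
    by_cases hpq : p ∈ X ∧ q ∈ X ∧ p ≠ q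
    · obtain ⟨x, rk, J, h⟩ := exists_isArcOrder hX hgen hpq.1 hpq.2.1 hpq.2.2
      exact ⟨x, rk, J, fun _ _ _ => h⟩
    · exact ⟨fun _ => 0, fun _ => 0, 0, fun hp hq hne => absurd ⟨hp, hq, hne⟩ hpq⟩
  choose x rk J hA using hex
  obtain ⟨c, hper, hmem, hne, hmod, hr⟩ := exists_closed_trail X r hr1 hr2
  have h : IsTrailSystem X x rk J c (r * X.card) :=
    { general := hgen
      isArcOrder := fun p hp q hq hpq => hA p q hp hq hpq
      two_le := by nlinarith
      periodic := hper
      mem := hmem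
      ne_succ := hne
      modEq := hmod }
  have hL : 2 * r * X.card.choose 2 = r * X.card * (X.card - 1) := by
    have := Nat.div_two_mul_two_of_even (Nat.even_mul_pred_self X.card)
    rw [Nat.choose_two_right, mul_comm 2 r, mul_assoc, mul_comm 2, this, mul_assoc]
  exact ⟨_, hL ▸ h.isRainbowCycleS hr⟩
end

section
/- For every m ∈ {2, 4}, the flip graph of non-crossing perfect matchings G_m^M contains a 1-rainbow cycle, and for every m ∈ {6, 8}, the flip graph G_m^M contains a 2-rainbow cycle. -/
/-! Rainbow cycles in the flip graph of non-crossing perfect matchings on `2m`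
points in convex position, labeled by the elements of `ZMod (2m)` in clockwise
cyclic order. -/

/-- `x` lies on the arc strictly between `a` and `b` (going in the direction of
increasing labels) in the cyclic order on `ZMod n`. -/
def StrictBtw (n : ℕ) (a x b : ZMod n) : Prop :=
  0 < (x - a).val ∧ (x - a).val < (b - a).val

/-- Two unordered pairs of points cross: all four points are distinct and
exactly one endpoint of the second pair lies on each of the two arcs strictly
between the endpoints of the first pair. -/
def Crosses (n : ℕ) (e f : Sym2 (ZMod n)) : Prop :=
  ∃ a b c d : ZMod n, e = s(a, b) ∧ f = s(c, d) ∧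
    a ≠ b ∧ a ≠ c ∧ a ≠ d ∧ b ≠ c ∧ b ≠ d ∧ c ≠ d ∧
    StrictBtw n a c b ∧ StrictBtw n b d a

/-- A possible matching edge on `2m` points: an unordered pair of points with
odd difference (so that an even number of points lies on either side). -/
def IsMEdge (m : ℕ) (e : Sym2 (ZMod (2 * m))) : Prop :=
  ∃ i j : ZMod (2 * m), e = s(i, j) ∧ Odd (j - i).val

/-- A non-crossing perfect matching on the `2m` points: a set of matching
edges covering every point exactly once, no two of which cross. -/
def IsNCMatching (m : ℕ) (M : Finset (Sym2 (ZMod (2 * m)))) : Prop :=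
  (∀ e ∈ M, IsMEdge m e) ∧
  (∀ p : ZMod (2 * m), ∃! e, e ∈ M ∧ p ∈ e) ∧
  (∀ e ∈ M, ∀ f ∈ M, ¬ Crosses (2 * m) e f)

/-- An `r`-rainbow cycle of length `L` in the flip graph `G_m^M` of
non-crossing perfect matchings, encoded as an `L`-periodic sequence `V` of
matchings: consecutive matchings differ in a flip (`|M \ M'| = 2`, i.e. two
edges of `M` are replaced by the two other edges on the same four points, and
those two entering edges are the labels of the arc), no matching is visited
twice within a period, and every possible matching edge appears among the arc
labels (i.e. enters the matching) exactly `r` times per period. -/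
def IsRainbowCycleM (m r L : ℕ) (V : ℕ → Finset (Sym2 (ZMod (2 * m)))) : Prop :=
  0 < L ∧
  (∀ i, V (i + L) = V i) ∧
  (∀ i < L, ∀ j < L, V i = V j → i = j) ∧
  (∀ i, IsNCMatching m (V i)) ∧
  (∀ i, (V i \ V (i + 1)).card = 2) ∧
  (∀ g : Sym2 (ZMod (2 * m)), IsMEdge m g →
    ((Finset.range L).filter (fun i => g ∈ V (i + 1) ∧ g ∉ V i)).card = r)

/-- The set of edges `{i, p i}` of the matching with partner function `p`. -/
def partnerEdges {n : ℕ} [NeZero n] (p : ZMod n → ZMod n) : Finset (Sym2 (ZMod n)) :=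
  Finset.univ.image fun i => s(i, p i)

section PartnerEdges

variable {n : ℕ} [NeZero n] {p q : ZMod n → ZMod n}

theorem mk_mem_partnerEdges (hp : ∀ i, p (p i) = i) (i j : ZMod n) :
    s(i, j) ∈ partnerEdges p ↔ p i = j := by
  simp only [partnerEdges, Finset.mem_image, Finset.mem_univ, true_and, Sym2.eq_iff]
  constructor
  · rintro ⟨a, ⟨rfl, rfl⟩ | ⟨rfl, rfl⟩⟩
    · rfl
    · exact hp a
  · rintro rfl
    exact ⟨i, .inl ⟨rfl, rfl⟩⟩

theorem partnerEdges_injective (hp : ∀ i, p (p i) = i) (hq : ∀ i, q (q i) = i)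
    (h : partnerEdges p = partnerEdges q) : p = q := by
  funext i
  have hi := (mk_mem_partnerEdges hp i (p i)).2 rfl
  rw [h, mk_mem_partnerEdges hq] at hi
  exact hi.symm

theorem card_partnerEdges_sdiff (hp : ∀ i, p (p i) = i) (hpi : ∀ i, p i ≠ i)
    (hq : ∀ i, q (q i) = i) :
    (partnerEdges p \ partnerEdges q).card =
      (Finset.univ.filter fun i => i.val < (p i).val ∧ p i ≠ q i).card := by
  symm
  refine Finset.card_bij (fun i _ => s(i, p i)) ?_ ?_ ?_
  · intro i hi
    rw [Finset.mem_filter] at hi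
    rw [Finset.mem_sdiff, mk_mem_partnerEdges hp, mk_mem_partnerEdges hq]
    exact ⟨rfl, hi.2.2.symm⟩
  · intro i hi j hj h
    rw [Finset.mem_filter] at hi hj
    rcases Sym2.eq_iff.1 h with h | ⟨h₁, h₂⟩
    · exact h.1
    · have hlt := hi.2.1
      rw [h₂, h₁] at hlt
      exact absurd hj.2.1 hlt.asymm
  · intro e
    induction e with | _ a b => ?_
    rw [Finset.mem_sdiff, mk_mem_partnerEdges hp, mk_mem_partnerEdges hq]
    rintro ⟨rfl, hqa⟩
    rcases lt_trichotomy a.val (p a).val with hlt | heq | hgt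
    · exact ⟨a, by simpa using ⟨hlt, Ne.symm hqa⟩, rfl⟩
    · exact absurd (ZMod.val_injective n heq).symm (hpi a)
    · refine ⟨p a, ?_, ?_⟩
      · rw [Finset.mem_filter, hp]
        exact ⟨Finset.mem_univ _, hgt, fun h => hqa (by rw [h, hq, ← h])⟩
      · rw [hp, Sym2.eq_swap]

end PartnerEdges

theorem isNCMatching_partnerEdges {m : ℕ} [NeZero (2 * m)] {p : ZMod (2 * m) → ZMod (2 * m)}
    (hp : ∀ i, p (p i) = i) (hodd : ∀ i, Odd (p i - i).val)
    (hcross : ∀ a c, ¬ (StrictBtw (2 * m) a c (p a) ∧ StrictBtw (2 * m) (p a) (p c) a)) :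
    IsNCMatching m (partnerEdges p) := by
  refine ⟨?_, ?_, ?_⟩
  · intro e he
    obtain ⟨i, -, rfl⟩ := Finset.mem_image.1 he
    exact ⟨i, p i, rfl, hodd i⟩
  · intro i
    refine ⟨s(i, p i), ⟨(mk_mem_partnerEdges hp _ _).2 rfl, Sym2.mem_mk_left _ _⟩, ?_⟩
    rintro e ⟨he, j, rfl⟩
    rw [(mk_mem_partnerEdges hp _ _).1 he]
  · rintro e he f hf ⟨a, b, c, d, rfl, rfl, -, -, -, -, -, -, hacb, hbda⟩
    rw [mk_mem_partnerEdges hp] at he hf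
    subst he hf
    exact hcross a c ⟨hacb, hbda⟩

/-- A periodic sequence of partner functions gives a rainbow cycle as soon as the defining
conditions hold over one period. -/
theorem isRainbowCycleM_partnerEdges {m r L : ℕ} [NeZero (2 * m)]
    {p : ℕ → ZMod (2 * m) → ZMod (2 * m)} (hL : 0 < L) (hper : ∀ k, p (k + L) = p k)
    (hp : ∀ k < L, ∀ i, p k (p k i) = i)
    (hodd : ∀ k < L, ∀ i, (p k i - i).val % 2 = 1)
    (hcross : ∀ k < L, ∀ a c, ¬ ((0 < (c - a).val ∧ (c - a).val < (p k a - a).val) ∧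
      0 < (p k c - p k a).val ∧ (p k c - p k a).val < (a - p k a).val))
    (hne : ∀ k < L, ∀ l < k, ∃ i, p k i ≠ p l i)
    (hflip : ∀ k < L,
      (Finset.univ.filter fun i => i.val < (p k i).val ∧ p k i ≠ p (k + 1) i).card = 2)
    (hcount : ∀ i j : ZMod (2 * m), (j - i).val % 2 = 1 →
      ((Finset.range L).filter fun k => p (k + 1) i = j ∧ p k i ≠ j).card = r) :
    IsRainbowCycleM m r L fun k => partnerEdges (p k) := by
  have hmod : ∀ k, p k = p (k % L) := fun k => (Function.Periodic.map_mod_nat hper k).symm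
  have hlt : ∀ k, k % L < L := fun k => Nat.mod_lt k hL
  have hp' : ∀ k i, p k (p k i) = i := fun k => by
    rw [hmod k]
    exact hp _ (hlt k)
  have hodd' : ∀ k i, Odd (p k i - i).val := fun k i => by
    rw [hmod k, Nat.odd_iff]
    exact hodd _ (hlt k) i
  have hne' : ∀ k < L, ∀ l < k, partnerEdges (p k) ≠ partnerEdges (p l) := by
    intro k hk l hl h
    obtain ⟨i, hi⟩ := hne k hk l hl
    exact hi (congrFun (partnerEdges_injective (hp' k) (hp' l) h) i)
  refine ⟨hL, fun k => by simp only [hper], ?_, ?_, ?_, ?_⟩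
  · intro k hk l hl h
    rcases lt_trichotomy k l with hkl | hkl | hkl
    · exact absurd h.symm (hne' l hl k hkl)
    · exact hkl
    · exact absurd h (hne' k hk l hkl)
  · intro k
    refine isNCMatching_partnerEdges (hp' k) (hodd' k) ?_
    rw [hmod k]
    exact hcross _ (hlt k)
  · intro k
    have hsucc : p (k + 1) = p (k % L + 1) := by
      rw [hmod (k + 1), hmod (k % L + 1), Nat.mod_add_mod]
    rw [card_partnerEdges_sdiff (hp' k) _ (hp' (k + 1)), hsucc, hmod k]
    · exact hflip _ (hlt k)
    · intro i hi
      have := hodd' k i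
      simp [hi] at this
  · rintro g ⟨i, j, rfl, hij⟩
    simp only [mk_mem_partnerEdges (hp' _)]
    exact hcount i j (Nat.odd_iff.1 hij)

/-- The partner functions listed in `B`, repeated over and over, with a rotation by a further
`t` points after each pass through the list. -/
def rotatedPartner (n t : ℕ) (B : List (List ℕ)) (k : ℕ) (i : ZMod n) : ZMod n :=
  let c : ZMod n := (t * (k / B.length) : ℕ)
  ((B.getD (k % B.length) []).getD (i - c).val 0 : ℕ) + c

theorem rotatedPartner_add_period {n t : ℕ} {B : List (List ℕ)} (hB : 0 < B.length) {s : ℕ}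
    (hs : n ∣ t * s) (k : ℕ) :
    rotatedPartner n t B (k + s * B.length) = rotatedPartner n t B k := by
  funext i
  have hc : ((t * s : ℕ) : ZMod n) = 0 := (ZMod.natCast_eq_zero_iff _ _).2 hs
  simp only [rotatedPartner, Nat.add_mul_mod_self_right, Nat.add_mul_div_right _ _ hB, mul_add,
    Nat.cast_add, hc, add_zero]

theorem isRainbowCycleM_two :
    IsRainbowCycleM 2 1 2 fun k => partnerEdges (rotatedPartner (2 * 2) 0
     [[1, 0, 3, 2],
      [3, 2, 1, 0]] k) :=
  isRainbowCycleM_partnerEdges (by decide)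
    (rotatedPartner_add_period (by decide) (s := 1) (by decide))
    (by decide +kernel) (by decide +kernel) (by decide +kernel) (by decide +kernel)
    (by decide +kernel) (by decide +kernel)

theorem isRainbowCycleM_four :
    IsRainbowCycleM 4 1 8 fun k => partnerEdges (rotatedPartner (2 * 4) 5
     [[1, 0, 3, 2, 7, 6, 5, 4]] k) :=
  isRainbowCycleM_partnerEdges (by decide)
    (rotatedPartner_add_period (by decide) (s := 8) (by decide))
    (by decide +kernel) (by decide +kernel) (by decide +kernel) (by decide +kernel)
    (by decide +kernel) (by decide +kernel)

theorem isRainbowCycleM_six :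
    IsRainbowCycleM 6 2 36 fun k => partnerEdges (rotatedPartner (2 * 6) 10
     [[1, 0, 3, 2, 5, 4, 11, 8, 7, 10, 9, 6],
      [11, 6, 3, 2, 5, 4, 1, 8, 7, 10, 9, 0],
      [11, 10, 3, 2, 5, 4, 9, 8, 7, 6, 1, 0],
      [11, 4, 3, 2, 1, 10, 9, 8, 7, 6, 5, 0],
      [5, 4, 3, 2, 1, 0, 9, 8, 7, 6, 11, 10],
      [9, 4, 3, 2, 1, 6, 5, 8, 7, 0, 11, 10]] k) :=
  isRainbowCycleM_partnerEdges (by decide)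
    (rotatedPartner_add_period (by decide) (s := 6) (by decide))
    (by decide +kernel) (by decide +kernel) (by decide +kernel) (by decide +kernel)
    (by decide +kernel) (by decide +kernel)

theorem isRainbowCycleM_eight :
    IsRainbowCycleM 8 2 64 fun k => partnerEdges (rotatedPartner (2 * 8) 2
     [[1, 0, 3, 2, 5, 4, 7, 6, 15, 10, 9, 12, 11, 14, 13, 8],
      [15, 8, 3, 2, 5, 4, 7, 6, 1, 10, 9, 12, 11, 14, 13, 0],
      [15, 14, 3, 2, 5, 4, 7, 6, 13, 10, 9, 12, 11, 8, 1, 0],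
      [15, 14, 3, 2, 13, 8, 7, 6, 5, 10, 9, 12, 11, 4, 1, 0],
      [15, 14, 3, 2, 9, 8, 7, 6, 5, 4, 13, 12, 11, 10, 1, 0],
      [15, 4, 3, 2, 1, 8, 7, 6, 5, 14, 13, 12, 11, 10, 9, 0],
      [15, 4, 3, 2, 1, 14, 7, 6, 9, 8, 13, 12, 11, 10, 5, 0],
      [15, 4, 3, 2, 1, 10, 7, 6, 9, 8, 5, 12, 11, 14, 13, 0]] k) :=
  isRainbowCycleM_partnerEdges (by decide)
    (rotatedPartner_add_period (by decide) (s := 8) (by decide))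
    (by decide +kernel) (by decide +kernel) (by decide +kernel) (by decide +kernel)
    (by decide +kernel) (by decide +kernel)

/-- For every `m ∈ {2, 4}`, the flip graph of non-crossing perfect matchings
on `2m` points contains a 1-rainbow cycle (of length `m²/2`), and for every
`m ∈ {6, 8}` it contains a 2-rainbow cycle (of length `m²`). -/
theorem matchings_small_rainbow_cycles :
    (∀ m ∈ ({2, 4} : Finset ℕ),
      ∃ V : ℕ → Finset (Sym2 (ZMod (2 * m))),
        IsRainbowCycleM m 1 (m ^ 2 / 2) V) ∧
    (∀ m ∈ ({6, 8} : Finset ℕ),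
      ∃ V : ℕ → Finset (Sym2 (ZMod (2 * m))),
        IsRainbowCycleM m 2 (m ^ 2) V) := by
  simp only [Finset.mem_insert, Finset.mem_singleton, forall_eq_or_imp, forall_eq]
  exact ⟨⟨⟨_, isRainbowCycleM_two⟩, ⟨_, isRainbowCycleM_four⟩⟩,
    ⟨_, isRainbowCycleM_six⟩, ⟨_, isRainbowCycleM_eight⟩⟩
end

section
/- Let m ≥ 2 be even and r ≥ 1. Every arc of an r-rainbow cycle in the flip graph of non-crossing perfect matchings G_m^M is a centered flip. -/
/-- The length of a matching edge `{i, j}`: the minimum number of matching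
edges that can lie on either of its two sides, i.e.
`min ((j-i-1)/2, (2m-(j-i)-1)/2)` where differences are taken mod `2m`. -/
def edgeLen (m : ℕ) : Sym2 (ZMod (2 * m)) → ℕ :=
  Sym2.lift ⟨fun i j => min (((j - i).val - 1) / 2) (((i - j).val - 1) / 2),
    fun i j => min_comm _ _⟩

theorem ZMod.val_sub_eq_ite {n : ℕ} [NeZero n] (p q : ZMod n) :
    (p - q).val = if q.val ≤ p.val then p.val - q.val else p.val + n - q.val := by
  split_ifs with h
  · exact ZMod.val_sub h
  · have h1 : (q - p).val = q.val - p.val := ZMod.val_sub (by omega)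
    have h2 : q - p ≠ 0 := by
      intro h0
      rw [h0, ZMod.val_zero] at h1
      omega
    have hq := ZMod.val_lt q
    rw [← neg_sub, ZMod.neg_val, if_neg h2, h1]
    omega

theorem edgeLen_mk (m : ℕ) (i j : ZMod (2 * m)) :
    edgeLen m s(i, j) = min (((j - i).val - 1) / 2) (((i - j).val - 1) / 2) := rfl

theorem IsMEdge.ne {m : ℕ} {i j : ZMod (2 * m)} (h : IsMEdge m s(i, j)) : i ≠ j := by
  rintro rfl
  obtain ⟨a, b, hab, hodd⟩ := h
  rw [Sym2.eq_iff] at hab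
  obtain ⟨rfl, rfl⟩ | ⟨rfl, rfl⟩ := hab <;> simp at hodd

theorem isMEdge_mk_iff {m : ℕ} [NeZero (2 * m)] {i j : ZMod (2 * m)} :
    IsMEdge m s(i, j) ↔ Odd (j - i).val := by
  refine ⟨?_, fun h => ⟨i, j, rfl, h⟩⟩
  rintro ⟨a, b, hab, hodd⟩
  rw [Sym2.eq_iff] at hab
  obtain ⟨rfl, rfl⟩ | ⟨rfl, rfl⟩ := hab
  · exact hodd
  · have h1 := ZMod.val_lt i
    have h2 := ZMod.val_lt j
    rw [ZMod.val_sub_eq_ite] at hodd ⊢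
    rw [Nat.odd_iff] at hodd ⊢
    split_ifs at hodd ⊢ <;> omega

namespace IsNCMatching

variable {m : ℕ} {M M' : Finset (Sym2 (ZMod (2 * m)))}

theorem eq_of_mem (hM : IsNCMatching m M) {e f : Sym2 (ZMod (2 * m))} {p : ZMod (2 * m)}
    (he : e ∈ M) (hf : f ∈ M) (hpe : p ∈ e) (hpf : p ∈ f) : e = f :=
  (hM.2.1 p).unique ⟨he, hpe⟩ ⟨hf, hpf⟩

theorem exists_partner (hM : IsNCMatching m M) (p : ZMod (2 * m)) : ∃ q, s(p, q) ∈ M := by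
  obtain ⟨e, ⟨he, q, rfl⟩, -⟩ := hM.2.1 p
  exact ⟨q, he⟩

/-- The edges leaving and entering a matching in a step cover the same points. -/
theorem exists_mem_sdiff (hM : IsNCMatching m M) (hM' : IsNCMatching m M')
    {e : Sym2 (ZMod (2 * m))} {p : ZMod (2 * m)} (he : e ∈ M \ M') (hp : p ∈ e) :
    ∃ q, s(p, q) ∈ M' \ M := by
  obtain ⟨q, hq⟩ := hM'.exists_partner p
  rw [Finset.mem_sdiff] at he
  refine ⟨q, Finset.mem_sdiff.2 ⟨hq, fun h => he.2 ?_⟩⟩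
  rwa [hM.eq_of_mem he.1 h hp (Sym2.mem_mk_left p q)]

theorem sdiff_eq_pair (hM : IsNCMatching m M) (hM' : IsNCMatching m M')
    {a b c d : ZMod (2 * m)} (hS : M \ M' = {s(a, b), s(c, d)})
    (hac : s(a, c) ∈ M' \ M) : M' \ M = {s(a, c), s(b, d)} := by
  have hsub : ∀ p q, s(p, q) ∈ M' \ M → p = a ∨ p = b ∨ p = c ∨ p = d := by
    intro p q h
    obtain ⟨t, ht⟩ := hM'.exists_mem_sdiff hM h (Sym2.mem_mk_left p q)
    simp only [hS, Finset.mem_insert, Finset.mem_singleton, Sym2.eq_iff] at ht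
    tauto
  have habM : s(a, b) ∈ M \ M' := by simp [hS]
  have hab := (hM.1 _ (Finset.mem_sdiff.1 habM).1).ne
  have hbd : s(b, d) ∈ M' \ M := by
    obtain ⟨q, hq⟩ := hM.exists_mem_sdiff hM' habM (Sym2.mem_mk_right a b)
    rcases hsub q b (by rwa [Sym2.eq_swap]) with rfl | rfl | rfl | rfl
    · rw [Sym2.eq_swap] at hq
      exact absurd (Finset.mem_sdiff.1 habM).1 (Finset.mem_sdiff.1 hq).2
    · exact absurd rfl (hM'.1 _ (Finset.mem_sdiff.1 hq).1).ne
    · have := hM'.eq_of_mem (Finset.mem_sdiff.1 hq).1 (Finset.mem_sdiff.1 hac).1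
        (Sym2.mem_mk_right _ _) (Sym2.mem_mk_right _ _)
      rw [Sym2.congr_left] at this
      exact absurd this.symm hab
    · exact hq
  ext e
  constructor
  · induction e with | _ p q =>
    intro h
    have h1 := (Finset.mem_sdiff.1 h).1
    have h2 := (Finset.mem_sdiff.1 hac).1
    have h3 := (Finset.mem_sdiff.1 hbd).1
    rw [Finset.mem_insert, Finset.mem_singleton]
    rcases hsub p q h with rfl | rfl | rfl | rfl
    · exact .inl (hM'.eq_of_mem h1 h2 (Sym2.mem_mk_left _ _) (Sym2.mem_mk_left _ _))
    · exact .inr (hM'.eq_of_mem h1 h3 (Sym2.mem_mk_left _ _) (Sym2.mem_mk_left _ _))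
    · exact .inl (hM'.eq_of_mem h1 h2 (Sym2.mem_mk_left _ _) (Sym2.mem_mk_right _ _))
    · exact .inr (hM'.eq_of_mem h1 h3 (Sym2.mem_mk_left _ _) (Sym2.mem_mk_right _ _))
  · rw [Finset.mem_insert, Finset.mem_singleton]
    rintro (rfl | rfl) <;> assumption

/-- A flip replaces two edges by two edges on the same four points. -/
theorem exists_flip (hM : IsNCMatching m M) (hM' : IsNCMatching m M')
    (hcard : (M \ M').card = 2) :
    ∃ a b c d, s(a, b) ≠ s(c, d) ∧ M \ M' = {s(a, b), s(c, d)} ∧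
      M' \ M = {s(a, c), s(b, d)} := by
  obtain ⟨e, f, hef, hS⟩ := Finset.card_eq_two.1 hcard
  induction e with | _ a b =>
  induction f with | _ c d =>
  have habM : s(a, b) ∈ M \ M' := by simp [hS]
  obtain ⟨q, hq⟩ := hM.exists_mem_sdiff hM' habM (Sym2.mem_mk_left a b)
  obtain ⟨t, ht⟩ := hM'.exists_mem_sdiff hM hq (Sym2.mem_mk_right a q)
  have hmem : q = a ∨ q = b ∨ q = c ∨ q = d := by
    simp only [hS, Finset.mem_insert, Finset.mem_singleton, Sym2.eq_iff] at ht
    tauto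
  rcases hmem with rfl | rfl | rfl | rfl
  · exact absurd rfl (hM'.1 _ (Finset.mem_sdiff.1 hq).1).ne
  · exact absurd (Finset.mem_sdiff.1 habM).1 (Finset.mem_sdiff.1 hq).2
  · exact ⟨a, b, q, d, hef, hS, hM.sdiff_eq_pair hM' hS hq⟩
  · rw [Sym2.eq_swap (a := c)] at hS hef
    exact ⟨a, b, q, c, hef, hS, hM.sdiff_eq_pair hM' hS hq⟩

end IsNCMatching

theorem crosses_of_val_lt {n : ℕ} [NeZero n] {a b c d : ZMod n}
    (h0 : 0 < (c - a).val) (hcb : (c - a).val < (b - a).val)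
    (hbd : (b - a).val < (d - a).val) : Crosses n s(a, b) s(c, d) := by
  have hd := ZMod.val_lt (d - a)
  have h1 : (d - b).val = (d - a).val - (b - a).val := by
    rw [← sub_sub_sub_cancel_right d b a, ZMod.val_sub hbd.le]
  have h2 : (a - b).val = n - (b - a).val := by
    have h := ZMod.val_sub_eq_ite (a - a) (b - a)
    rw [sub_sub_sub_cancel_right, sub_self, ZMod.val_zero, if_neg (by omega)] at h
    omega
  refine ⟨a, b, c, d, rfl, rfl, ?_, ?_, ?_, ?_, ?_, ?_, ⟨h0, hcb⟩, ?_, ?_⟩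
  · rintro rfl; simp at hcb
  · rintro rfl; simp at h0
  · rintro rfl; simp at hbd
  · rintro rfl; simp at hcb
  · rintro rfl; simp at hbd
  · rintro rfl; omega
  · omega
  · omega

/-- The sides of a convex quadrilateral have total length at most `m - 2`. -/
theorem edgeLen_quadrilateral_le {m : ℕ} [NeZero (2 * m)] {a b c d : ZMod (2 * m)}
    (h0 : 0 < (b - a).val) (hbc : (b - a).val < (c - a).val)
    (hcd : (c - a).val < (d - a).val) :
    edgeLen m s(a, b) + edgeLen m s(b, c) + edgeLen m s(c, d) + edgeLen m s(d, a) ≤ m - 2 := by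
  have hd := ZMod.val_lt (d - a)
  have h1 : (c - b).val = (c - a).val - (b - a).val := by
    rw [← sub_sub_sub_cancel_right c b a, ZMod.val_sub hbc.le]
  have h2 : (d - c).val = (d - a).val - (c - a).val := by
    rw [← sub_sub_sub_cancel_right d c a, ZMod.val_sub hcd.le]
  have h3 : (a - d).val = 2 * m - (d - a).val := by
    have h := ZMod.val_sub_eq_ite (a - a) (d - a)
    rw [sub_sub_sub_cancel_right, sub_self, ZMod.val_zero, if_neg (by omega)] at h
    omega
  have h4 : edgeLen m s(a, b) ≤ ((b - a).val - 1) / 2 := min_le_left _ _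
  have h5 : edgeLen m s(b, c) ≤ ((c - b).val - 1) / 2 := min_le_left _ _
  have h6 : edgeLen m s(c, d) ≤ ((d - c).val - 1) / 2 := min_le_left _ _
  have h7 : edgeLen m s(d, a) ≤ ((a - d).val - 1) / 2 := min_le_left _ _
  omega

theorem IsNCMatching.sum_edgeLen_flip_le {m : ℕ} [NeZero (2 * m)]
    {M M' : Finset (Sym2 (ZMod (2 * m)))} (hM : IsNCMatching m M) (hM' : IsNCMatching m M')
    (hcard : (M \ M').card = 2) :
    ∑ e ∈ (M \ M') ∪ (M' \ M), edgeLen m e ≤ m - 2 := by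
  obtain ⟨a, b, c, d, hne, hS, hT⟩ := hM.exists_flip hM' hcard
  have hab : s(a, b) ∈ M := (Finset.mem_sdiff.1 (show s(a, b) ∈ M \ M' by simp [hS])).1
  have hac : s(a, c) ∈ M' := (Finset.mem_sdiff.1 (show s(a, c) ∈ M' \ M by simp [hT])).1
  have hcd : s(c, d) ∈ M := (Finset.mem_sdiff.1 (show s(c, d) ∈ M \ M' by simp [hS])).1
  have hbd : s(b, d) ∈ M' := (Finset.mem_sdiff.1 (show s(b, d) ∈ M' \ M by simp [hT])).1
  have had : a ≠ d := by
    rintro rfl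
    exact hne (hM.eq_of_mem hab hcd (Sym2.mem_mk_left _ _) (Sym2.mem_mk_right _ _))
  have hbc : b ≠ c := by
    rintro rfl
    exact hne (hM.eq_of_mem hab hcd (Sym2.mem_mk_right _ _) (Sym2.mem_mk_left _ _))
  have hpos : ∀ x, a ≠ x → 0 < (x - a).val := fun x hx =>
    Nat.pos_of_ne_zero fun h => hx (sub_eq_zero.1 ((ZMod.val_eq_zero _).1 h)).symm
  have hinj : ∀ x y, x ≠ y → (x - a).val ≠ (y - a).val := fun x y hxy h =>
    hxy (sub_left_injective (ZMod.val_injective _ h))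
  have hb := hpos b (hM.1 _ hab).ne
  have hc := hpos c (hM'.1 _ hac).ne
  have hd := hpos d had
  have hbc' := hinj b c hbc
  have hbd' := hinj b d (hM'.1 _ hbd).ne
  have hcd' := hinj c d (hM.1 _ hcd).ne
  have x1 : ¬ ((c - a).val < (b - a).val ∧ (b - a).val < (d - a).val) := fun h =>
    hM.2.2 _ hab _ hcd (crosses_of_val_lt hc h.1 h.2)
  have x2 : ¬ ((d - a).val < (b - a).val ∧ (b - a).val < (c - a).val) := fun h =>
    hM.2.2 _ hab _ hcd (Sym2.eq_swap (a := c) ▸ crosses_of_val_lt hd h.1 h.2)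
  have x3 : ¬ ((b - a).val < (c - a).val ∧ (c - a).val < (d - a).val) := fun h =>
    hM'.2.2 _ hac _ hbd (crosses_of_val_lt hb h.1 h.2)
  have x4 : ¬ ((d - a).val < (c - a).val ∧ (c - a).val < (b - a).val) := fun h =>
    hM'.2.2 _ hac _ hbd (Sym2.eq_swap (a := b) ▸ crosses_of_val_lt hd h.1 h.2)
  have hle : ∀ e f : Sym2 (ZMod (2 * m)),
      ∑ x ∈ ({e, f} : Finset _), edgeLen m x ≤ edgeLen m e + edgeLen m f := by
    intro e f
    by_cases h : e = f
    · simp [h]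
    · rw [Finset.sum_pair h]
  rw [Finset.sum_union disjoint_sdiff_sdiff, hS, hT]
  refine (add_le_add (hle _ _) (hle _ _)).trans ?_
  by_cases h : (b - a).val < (d - a).val
  · have := edgeLen_quadrilateral_le hb h (show (d - a).val < (c - a).val by omega)
    rw [Sym2.eq_swap (a := d), Sym2.eq_swap (a := c) (b := a)] at this
    omega
  · have := edgeLen_quadrilateral_le hc (show (c - a).val < (d - a).val by omega)
      (show (d - a).val < (b - a).val by omega)
    rw [Sym2.eq_swap (a := d), Sym2.eq_swap (a := b) (b := a)] at this
    omega

theorem edgeLen_add_edgeLen_opposite {m : ℕ} [NeZero (2 * m)] (heven : Even m)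
    {i j : ZMod (2 * m)} (h : Odd (j - i).val) :
    Odd (j + m - i).val ∧ 2 * (edgeLen m s(i, j) + edgeLen m s(i, j + m)) = m - 2 := by
  have hm : 0 < m := by have := NeZero.pos (2 * m); omega
  obtain ⟨k, hk⟩ := heven
  have hlt := ZMod.val_lt (j - i)
  have hmv : (m : ZMod (2 * m)).val = m := ZMod.val_natCast_of_lt (by omega)
  have hneg : -(m : ZMod (2 * m)) = m := by
    rw [neg_eq_iff_add_eq_zero, ← Nat.cast_add, ← two_mul, ZMod.natCast_self]
  have h1 : (j + m - i).val =
      if m ≤ (j - i).val then (j - i).val - m else (j - i).val + 2 * m - m := by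
    have := ZMod.val_sub_eq_ite (j - i) (m : ZMod (2 * m))
    rw [hmv, sub_eq_add_neg (j - i), hneg, sub_add_eq_add_sub] at this
    exact this
  have hn : ∀ x : ZMod (2 * m), x.val ≠ 0 → (-x).val = 2 * m - x.val := fun x hx => by
    rw [ZMod.neg_val, if_neg (fun h => hx ((ZMod.val_eq_zero x).2 h))]
  rw [Nat.odd_iff] at h
  have h2 := hn (j - i) (by omega)
  have hodd : (j + m - i).val % 2 = 1 := by split_ifs at h1 <;> omega
  have h3 := hn (j + m - i) (by omega)
  rw [neg_sub] at h2 h3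
  refine ⟨Nat.odd_iff.2 hodd, ?_⟩
  rw [edgeLen_mk, edgeLen_mk, h2, h3]
  split_ifs at h1 <;> omega

open Classical in
theorem sum_isMEdge_mul_two {m : ℕ} [NeZero (2 * m)] (f : Sym2 (ZMod (2 * m)) → ℕ) :
    ∑ p : ZMod (2 * m) × ZMod (2 * m) with Odd (p.2 - p.1).val, f s(p.1, p.2) =
      ∑ e : Sym2 (ZMod (2 * m)) with IsMEdge m e, 2 * f e := by
  rw [← Finset.sum_fiberwise_of_maps_to (t := Finset.univ.filter (IsMEdge m))
    (g := fun p : ZMod (2 * m) × ZMod (2 * m) => s(p.1, p.2))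
    (fun p hp => by simpa [isMEdge_mk_iff] using hp)]
  refine Finset.sum_congr rfl fun e he => ?_
  induction e with | _ i j =>
  have hE : IsMEdge m s(i, j) := (Finset.mem_filter.1 he).2
  have hS : (Finset.univ.filter fun p : ZMod (2 * m) × ZMod (2 * m) =>
      Odd (p.2 - p.1).val).filter (fun p => s(p.1, p.2) = s(i, j)) = {(i, j), (j, i)} := by
    ext ⟨p, q⟩
    simp only [Finset.mem_filter, Finset.mem_univ, true_and, Finset.mem_insert,
      Finset.mem_singleton, Prod.mk.injEq, ← isMEdge_mk_iff, ← Sym2.eq_iff]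
    exact ⟨fun h => h.2, fun h => ⟨h ▸ hE, h⟩⟩
  rw [hS, Finset.sum_pair (fun h => hE.ne (Prod.mk.inj h).1), two_mul (f s(i, j))]
  exact congrArg (f s(i, j) + f ·) Sym2.eq_swap

open Classical in
/-- The average length of a matching edge is `(m - 2) / 4`. -/
theorem sum_isMEdge_edgeLen {m : ℕ} [NeZero (2 * m)] (heven : Even m) :
    ∑ e : Sym2 (ZMod (2 * m)) with IsMEdge m e, 4 * edgeLen m e =
      ∑ e : Sym2 (ZMod (2 * m)) with IsMEdge m e, (m - 2) := by
  have hneg : (m : ZMod (2 * m)) + m = 0 := by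
    rw [← Nat.cast_add, ← two_mul, ZMod.natCast_self]
  have key : ∑ p : ZMod (2 * m) × ZMod (2 * m) with Odd (p.2 - p.1).val, edgeLen m s(p.1, p.2) =
      ∑ p : ZMod (2 * m) × ZMod (2 * m) with Odd (p.2 - p.1).val,
        edgeLen m s(p.1, p.2 + m) := by
    have hmaps : ∀ p ∈ Finset.univ.filter (fun p : ZMod (2 * m) × ZMod (2 * m) =>
        Odd (p.2 - p.1).val), (p.1, p.2 + (m : ZMod (2 * m))) ∈
          Finset.univ.filter (fun p : ZMod (2 * m) × ZMod (2 * m) => Odd (p.2 - p.1).val) := by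
      intro p hp
      simpa using (edgeLen_add_edgeLen_opposite heven (Finset.mem_filter.1 hp).2).1
    refine Finset.sum_bij' (fun p _ => (p.1, p.2 + (m : ZMod (2 * m))))
      (fun p _ => (p.1, p.2 + (m : ZMod (2 * m)))) hmaps hmaps ?_ ?_ ?_ <;>
      simp [add_assoc, hneg]
  have hsum : ∑ p : ZMod (2 * m) × ZMod (2 * m) with Odd (p.2 - p.1).val,
      2 * (edgeLen m s(p.1, p.2) + edgeLen m s(p.1, p.2 + m)) =
      ∑ p : ZMod (2 * m) × ZMod (2 * m) with Odd (p.2 - p.1).val, (m - 2) :=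
    Finset.sum_congr rfl fun p hp =>
      (edgeLen_add_edgeLen_opposite heven (Finset.mem_filter.1 hp).2).2
  rw [← Finset.mul_sum, Finset.sum_add_distrib, ← key, sum_isMEdge_mul_two (edgeLen m),
    sum_isMEdge_mul_two (fun _ => m - 2), ← Finset.mul_sum, ← Finset.mul_sum] at hsum
  rw [← Finset.mul_sum]
  omega

namespace IsRainbowCycleM

variable {m r L : ℕ} {V : ℕ → Finset (Sym2 (ZMod (2 * m)))}

open Classical in
theorem sum_entering [NeZero (2 * m)] (hV : IsRainbowCycleM m r L V)
    (f : Sym2 (ZMod (2 * m)) → ℕ) :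
    ∑ i ∈ Finset.range L, ∑ e ∈ V (i + 1) \ V i, f e =
      r * ∑ e : Sym2 (ZMod (2 * m)) with IsMEdge m e, f e := by
  have h : ∀ i, V (i + 1) \ V i =
      (Finset.univ.filter (IsMEdge m)).filter (fun e => e ∈ V (i + 1) ∧ e ∉ V i) := by
    intro i
    ext e
    simp only [Finset.mem_sdiff, Finset.mem_filter, Finset.mem_univ, true_and]
    exact ⟨fun h => ⟨(hV.2.2.2.1 (i + 1)).1 e h.1, h⟩, fun h => h.2⟩
  simp_rw [h, Finset.sum_filter (fun e => e ∈ V _ ∧ e ∉ V _)]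
  rw [Finset.sum_comm, Finset.mul_sum]
  refine Finset.sum_congr rfl fun e he => ?_
  rw [← Finset.sum_filter, Finset.sum_const, smul_eq_mul]
  congr 1
  convert hV.2.2.2.2.2 e (Finset.mem_filter.1 he).2

theorem sum_leaving (hV : IsRainbowCycleM m r L V) (f : Sym2 (ZMod (2 * m)) → ℕ) :
    ∑ i ∈ Finset.range L, ∑ e ∈ V i \ V (i + 1), f e =
      ∑ i ∈ Finset.range L, ∑ e ∈ V (i + 1) \ V i, f e := by
  have hstep : ∀ i, (∑ e ∈ V i \ V (i + 1), f e) + ∑ e ∈ V (i + 1), f e =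
      (∑ e ∈ V (i + 1) \ V i, f e) + ∑ e ∈ V i, f e := by
    intro i
    have h1 := Finset.sum_inter_add_sum_sdiff (V i) (V (i + 1)) f
    have h2 := Finset.sum_inter_add_sum_sdiff (V (i + 1)) (V i) f
    rw [Finset.inter_comm] at h2
    omega
  have hsum := Finset.sum_congr (rfl : Finset.range L = _) fun i _ => hstep i
  have h0 : V L = V 0 := by simpa using hV.2.1 0
  have htel : ∑ i ∈ Finset.range L, ∑ e ∈ V (i + 1), f e =
      ∑ i ∈ Finset.range L, ∑ e ∈ V i, f e := by
    have h1 := Finset.sum_range_succ (fun i => ∑ e ∈ V i, f e) L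
    have h2 := Finset.sum_range_succ' (fun i => ∑ e ∈ V i, f e) L
    rw [h0] at h1
    omega
  rw [Finset.sum_add_distrib, Finset.sum_add_distrib, htel] at hsum
  omega

theorem sum_edgeLen [NeZero (2 * m)] (heven : Even m) (hV : IsRainbowCycleM m r L V) :
    ∑ i ∈ Finset.range L, ∑ e ∈ (V i \ V (i + 1)) ∪ (V (i + 1) \ V i), edgeLen m e =
      ∑ _i ∈ Finset.range L, (m - 2) := by
  simp_rw [fun i => Finset.sum_union (f := edgeLen m)
    (disjoint_sdiff_sdiff (x := V i) (y := V (i + 1)))]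
  have h1 := hV.sum_leaving fun _ => m - 2
  have h2 := congrArg (r * ·) (sum_isMEdge_edgeLen heven)
  rw [← hV.sum_entering, ← hV.sum_entering, ← h1] at h2
  simp only [Finset.sum_const, hV.2.2.2.2.1, smul_eq_mul, ← Finset.mul_sum] at h2
  rw [Finset.sum_add_distrib, hV.sum_leaving, Finset.sum_const, smul_eq_mul]
  linarith

end IsRainbowCycleM

/-- For even `m ≥ 2`, every arc of an `r`-rainbow cycle in the flip graph of
non-crossing perfect matchings is a centered flip, i.e. the four edges
involved in the flip have total length `m - 2`. -/
theorem rainbow_cycle_flips_are_centered (m r L : ℕ) (hm : 2 ≤ m)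
    (heven : Even m) (hr : 1 ≤ r) (V : ℕ → Finset (Sym2 (ZMod (2 * m))))
    (hV : IsRainbowCycleM m r L V) :
    ∀ i, ∑ e ∈ (V i \ V (i + 1)) ∪ (V (i + 1) \ V i), edgeLen m e = m - 2 := by
  have : NeZero (2 * m) := ⟨by omega⟩
  have hlt : ∀ i ∈ Finset.range L,
      ∑ e ∈ (V i \ V (i + 1)) ∪ (V (i + 1) \ V i), edgeLen m e = m - 2 :=
    (Finset.sum_eq_sum_iff_of_le fun i _ => (hV.2.2.2.1 i).sum_edgeLen_flip_le
      (hV.2.2.2.1 (i + 1)) (hV.2.2.2.2.1 i)).1 (hV.sum_edgeLen heven)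
  have hper : Function.Periodic
      (fun i => ∑ e ∈ (V i \ V (i + 1)) ∪ (V (i + 1) \ V i), edgeLen m e) L := by
    intro i
    simp only [add_right_comm i L 1, hV.2.1]
  intro i
  exact (hper.map_mod_nat i).symm.trans (hlt _ (Finset.mem_range.2 (Nat.mod_lt _ hV.1)))
end
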